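/- arXiv:1509.08675 — 7 statements merged into one kernel-verified Lean document; each statement's English description precedes it below -/
import Mathlib

section
/- Let 𝔄 be a unital complex Banach algebra and let S ∈ 𝔄 have spectrum contained in ℂ ∖ (−∞, 0]. Then for every t ∈ ℝ the element (cos²t)·1 + (sin²t)·S is invertible, S itself is invertible, and the element X := (1/2π)∫₀^{2π} ((cos²t)·1 + (sin²t)·S)⁻¹ dt commutes with S and satisfies X² = S⁻¹. -/
/-- `S^{-1/2} := (1/(2π)) ∫₀^{2π} ((cos²t)·1 + (sin²t)·S)⁻¹ dt` in a unital
complex Banach algebra. -/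
noncomputable def invSqrt {𝔄 : Type*} [NormedRing 𝔄] [NormedAlgebra ℂ 𝔄] [CompleteSpace 𝔄]
    (S : 𝔄) : 𝔄 :=
  (2 * Real.pi)⁻¹ • ∫ t in (0:ℝ)..(2 * Real.pi),
    Ring.inverse ((Real.cos t ^ 2) • (1 : 𝔄) + (Real.sin t ^ 2) • S)

/-- Inverses along the segment from `1` to `S`. -/
noncomputable def segmentInverse {𝔄 : Type*} [NormedRing 𝔄] [NormedAlgebra ℂ 𝔄] (S : 𝔄)
    (p : ℝ) : 𝔄 :=
  Ring.inverse ((1 : 𝔄) + p • (S - 1))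

section segmentInverse

variable {𝔄 : Type*} [NormedRing 𝔄] [NormedAlgebra ℂ 𝔄]

theorem cos_sq_smul_one_add_sin_sq_smul (S : 𝔄) (t : ℝ) :
    (Real.cos t ^ 2) • (1 : 𝔄) + (Real.sin t ^ 2) • S = 1 + (Real.sin t ^ 2) • (S - 1) := by
  rw [Real.cos_sq']
  module

theorem isUnit_one_add_smul_sub_one {S : 𝔄} (hS : ∀ z ∈ spectrum ℂ S, ¬(z.im = 0 ∧ z.re ≤ 0))
    {p : ℝ} (hp : p ∈ Set.Icc (0 : ℝ) 1) : IsUnit ((1 : 𝔄) + p • (S - 1)) := by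
  rcases hp.1.eq_or_lt with rfl | h0
  · simp
  have hz : ((-((1 - p) / p) : ℝ) : ℂ) ∉ spectrum ℂ S := fun h => hS _ h
    ⟨Complex.ofReal_im _, by
      rw [Complex.ofReal_re, neg_nonpos]
      exact div_nonneg (sub_nonneg.2 hp.2) h0.le⟩
  rw [spectrum.notMem_iff] at hz
  have hu : IsUnit (algebraMap ℝ 𝔄 (-p)) := (IsUnit.mk0 _ (neg_ne_zero.2 h0.ne')).map _
  convert hu.mul hz using 1
  rw [← Algebra.smul_def, Algebra.algebraMap_eq_smul_one, Complex.coe_smul,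
    smul_sub (-p), smul_smul]
  have : -p * -((1 - p) / p) = 1 - p := by field_simp
  rw [this]
  module

theorem Commute.segmentInverse_right {S a : 𝔄} (h : Commute a S) (p : ℝ) :
    Commute a (segmentInverse S p) := by
  have hc : Commute a (1 + p • (S - 1)) :=
    (Commute.one_right a).add_right ((h.sub_right (Commute.one_right a)).smul_right p)
  rw [segmentInverse]
  by_cases hU : IsUnit (1 + p • (S - 1))
  · obtain ⟨x, hx⟩ := hU
    rw [← hx] at hc ⊢
    rw [Ring.inverse_unit]
    exact hc.units_inv_right
  · rw [Ring.inverse_non_unit _ hU]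
    exact Commute.zero_right a

theorem smul_sub_one_mul_segmentInverse {S : 𝔄} {p : ℝ}
    (h : IsUnit ((1 : 𝔄) + p • (S - 1))) :
    p • ((S - 1) * segmentInverse S p * segmentInverse S p) =
      segmentInverse S p - segmentInverse S p * segmentInverse S p := by
  have h1 : (1 + p • (S - 1)) * segmentInverse S p = 1 := Ring.mul_inverse_cancel _ h
  have h2 : p • ((S - 1) * segmentInverse S p) = 1 - segmentInverse S p := by
    rw [add_mul, one_mul, smul_mul_assoc] at h1
    exact eq_sub_of_add_eq' h1
  rw [← smul_mul_assoc, h2, sub_mul, one_mul]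

theorem sin_sq_mul_sin_sq_mem_Icc (u t : ℝ) :
    Real.sin u ^ 2 * Real.sin t ^ 2 ∈ Set.Icc (0 : ℝ) 1 :=
  ⟨by positivity, mul_le_one₀ (Real.sin_sq_le_one u) (by positivity) (Real.sin_sq_le_one t)⟩

variable [CompleteSpace 𝔄]

theorem hasDerivAt_segmentInverse {S : 𝔄} {p : ℝ} (h : IsUnit ((1 : 𝔄) + p • (S - 1))) :
    HasDerivAt (segmentInverse S) (-((S - 1) * segmentInverse S p * segmentInverse S p)) p := by
  obtain ⟨x, hx⟩ := h
  have hd : HasDerivAt (fun p : ℝ => (1 : 𝔄) + p • (S - 1)) (S - 1) p := by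
    simpa using ((hasDerivAt_id p).smul_const (S - 1)).const_add (1 : 𝔄)
  have hi := hasFDerivAt_ringInverse (𝕜 := ℝ) x
  rw [hx] at hi
  have hR : (↑x⁻¹ : 𝔄) = segmentInverse S p := by
    rw [segmentInverse, ← hx, Ring.inverse_unit]
  have hc : Commute (S - 1) (segmentInverse S p) :=
    Commute.segmentInverse_right ((Commute.refl S).sub_left (Commute.one_left S)) p
  refine (hi.comp_hasDerivAt p hd).congr_deriv ?_
  simp [hR, hc.eq]

theorem intervalIntegral_const_mul_of_continuous {f : ℝ → 𝔄} {a b : ℝ} (c : 𝔄)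
    (hf : Continuous f) : ∫ t in a..b, c * f t = c * ∫ t in a..b, f t :=
  ((ContinuousLinearMap.mul ℝ 𝔄) c).intervalIntegral_comp_comm (hf.intervalIntegrable a b)

theorem intervalIntegral_mul_const_of_continuous {f : ℝ → 𝔄} {a b : ℝ} (c : 𝔄)
    (hf : Continuous f) : ∫ t in a..b, f t * c = (∫ t in a..b, f t) * c :=
  ((ContinuousLinearMap.mul ℝ 𝔄).flip c).intervalIntegral_comp_comm (hf.intervalIntegrable a b)

variable {S : 𝔄} (hS : ∀ p ∈ Set.Icc (0 : ℝ) 1, IsUnit ((1 : 𝔄) + p • (S - 1)))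
include hS

theorem continuous_segmentInverse_sin_sq (u : ℝ) :
    Continuous fun t : ℝ => segmentInverse S (Real.sin u ^ 2 * Real.sin t ^ 2) := by
  refine continuous_iff_continuousAt.2 fun t => ?_
  exact ContinuousAt.comp (g := segmentInverse S)
    (hasDerivAt_segmentInverse (hS _ (sin_sq_mul_sin_sq_mem_Icc u t))).continuousAt (by fun_prop)

theorem integral_segmentInverse_sub_eq_zero (u : ℝ) :
    (∫ t in (0 : ℝ)..(2 * Real.pi),
      (segmentInverse S (Real.sin u ^ 2 * Real.sin t ^ 2) -
        (2 * Real.sin t ^ 2) • ((1 + Real.sin u ^ 2 • (S - 1)) *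
          (segmentInverse S (Real.sin u ^ 2 * Real.sin t ^ 2) *
          segmentInverse S (Real.sin u ^ 2 * Real.sin t ^ 2))))) = 0 := by
  have hc := continuous_segmentInverse_sin_sq hS u
  rw [intervalIntegral.integral_eq_sub_of_hasDerivAt (f := fun t =>
    (Real.sin t * Real.cos t) • segmentInverse S (Real.sin u ^ 2 * Real.sin t ^ 2))]
  · simp
  · intro t _
    have hU := hS _ (sin_sq_mul_sin_sq_mem_Icc u t)
    have h1 := (hasDerivAt_segmentInverse hU).scomp t
      (((Real.hasDerivAt_sin t).pow 2).const_mul (Real.sin u ^ 2))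
    have h2 := ((Real.hasDerivAt_sin t).mul (Real.hasDerivAt_cos t)).smul h1
    refine h2.congr_deriv ?_
    have hk := smul_sub_one_mul_segmentInverse hU
    simp only [Function.comp_apply, add_mul, one_mul, smul_mul_assoc, ← mul_assoc]
    generalize hR : segmentInverse S (Real.sin u ^ 2 * Real.sin t ^ 2) = R at *
    generalize (S - 1) * R * R = Q at *
    generalize R * R = P at *
    have hcos : Real.cos t * Real.cos t = 1 - Real.sin t ^ 2 := by
      rw [← sq, Real.cos_sq']
    have hP : P = R - (Real.sin u ^ 2 * Real.sin t ^ 2) • Q := by rw [hk, sub_sub_cancel]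
    have hQ : Real.sin t * Real.cos t * (Real.sin u ^ 2 * 2 * Real.sin t * Real.cos t) =
        2 * Real.sin u ^ 2 * Real.sin t ^ 2 * (1 - Real.sin t ^ 2) := by
      rw [← hcos]
      ring
    simp only [Pi.mul_apply, Nat.cast_ofNat, Nat.add_one_sub_one, pow_one, smul_smul, smul_neg,
      hQ, hcos, hP]
    module
  · apply Continuous.intervalIntegrable
    fun_prop

theorem hasDerivAt_integral_segmentInverse (u : ℝ) :
    HasDerivAt (fun u : ℝ => ∫ t in (0 : ℝ)..(2 * Real.pi),
        segmentInverse S (Real.sin u ^ 2 * Real.sin t ^ 2))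
      (∫ t in (0 : ℝ)..(2 * Real.pi), (-(2 * Real.sin u * Real.cos u * Real.sin t ^ 2)) •
        ((S - 1) * segmentInverse S (Real.sin u ^ 2 * Real.sin t ^ 2) *
          segmentInverse S (Real.sin u ^ 2 * Real.sin t ^ 2))) u := by
  have hc := continuous_segmentInverse_sin_sq hS
  obtain ⟨M, hM⟩ := isCompact_Icc.exists_bound_of_continuousOn (s := Set.Icc (0 : ℝ) 1)
    (f := segmentInverse S)
    fun p hp => (hasDerivAt_segmentInverse (hS p hp)).continuousAt.continuousWithinAt
  refine (intervalIntegral.hasDerivAt_integral_of_dominated_loc_of_deriv_le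
    (F := fun (v t : ℝ) => segmentInverse S (Real.sin v ^ 2 * Real.sin t ^ 2))
    (F' := fun (v t : ℝ) => (-(2 * Real.sin v * Real.cos v * Real.sin t ^ 2)) •
        ((S - 1) * segmentInverse S (Real.sin v ^ 2 * Real.sin t ^ 2) *
          segmentInverse S (Real.sin v ^ 2 * Real.sin t ^ 2)))
    (bound := fun _ => 2 * (‖S - 1‖ * M * M)) Filter.univ_mem ?_ ?_ ?_ ?_ ?_ ?_).2
  · exact Filter.Eventually.of_forall fun v => (hc v).aestronglyMeasurable
  · exact (hc u).intervalIntegrable _ _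
  · have := hc u
    exact Continuous.aestronglyMeasurable (by fun_prop)
  · refine Filter.Eventually.of_forall fun t _ v _ => ?_
    have hb := hM _ (sin_sq_mul_sin_sq_mem_Icc v t)
    have hM0 : 0 ≤ M := (norm_nonneg _).trans hb
    rw [norm_smul]
    gcongr
    · rw [norm_neg, Real.norm_eq_abs, abs_mul, abs_mul, abs_mul, abs_two, abs_pow]
      have h1 := Real.abs_sin_le_one v
      have h2 := Real.abs_cos_le_one v
      have h3 : |Real.sin t| ^ 2 ≤ 1 := pow_le_one₀ (abs_nonneg _) (Real.abs_sin_le_one t)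
      calc 2 * |Real.sin v| * |Real.cos v| * |Real.sin t| ^ 2 ≤ 2 * 1 * 1 * 1 := by gcongr
        _ = 2 := by norm_num
    · refine (norm_mul₃_le).trans ?_
      gcongr
  · exact intervalIntegrable_const
  · refine Filter.Eventually.of_forall fun t _ v _ => ?_
    have h1 := (hasDerivAt_segmentInverse (hS _ (sin_sq_mul_sin_sq_mem_Icc v t))).scomp v
      (((Real.hasDerivAt_sin v).pow 2).mul_const (Real.sin t ^ 2))
    refine h1.congr_deriv ?_
    simp only [Nat.cast_ofNat, smul_neg, neg_smul]
    congr 2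
    ring

theorem Commute.integral_segmentInverse_right {a : 𝔄} (h : Commute a S) (u : ℝ) :
    Commute a (∫ t in (0 : ℝ)..(2 * Real.pi),
      segmentInverse S (Real.sin u ^ 2 * Real.sin t ^ 2)) := by
  have hc := continuous_segmentInverse_sin_sq hS u
  rw [Commute, SemiconjBy, ← intervalIntegral_const_mul_of_continuous a hc,
    ← intervalIntegral_mul_const_of_continuous a hc]
  simp only [(h.segmentInverse_right _).eq]

theorem integral_deriv_segmentInverse_mul (u : ℝ) :
    (∫ t in (0 : ℝ)..(2 * Real.pi), (-(2 * Real.sin u * Real.cos u * Real.sin t ^ 2)) •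
        ((S - 1) * segmentInverse S (Real.sin u ^ 2 * Real.sin t ^ 2) *
          segmentInverse S (Real.sin u ^ 2 * Real.sin t ^ 2))) * (1 + Real.sin u ^ 2 • (S - 1)) =
      -((Real.sin u * Real.cos u) • ((S - 1) * ∫ t in (0 : ℝ)..(2 * Real.pi),
        segmentInverse S (Real.sin u ^ 2 * Real.sin t ^ 2))) := by
  have hc := continuous_segmentInverse_sin_sq hS u
  have h0 := integral_segmentInverse_sub_eq_zero hS u
  have hD : Commute (1 + Real.sin u ^ 2 • (S - 1)) S :=
    (Commute.one_left S).add_left (((Commute.refl S).sub_left (Commute.one_left S)).smul_left _)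
  have hE := congrArg (fun x => (Real.sin u * Real.cos u) • ((S - 1) * x)) h0
  simp only [mul_zero, smul_zero] at hE
  rw [← intervalIntegral_const_mul_of_continuous _ (by fun_prop),
    ← intervalIntegral.integral_smul] at hE
  rw [eq_neg_iff_add_eq_zero, ← intervalIntegral_mul_const_of_continuous _ (by fun_prop),
    ← intervalIntegral_const_mul_of_continuous _ hc, ← intervalIntegral.integral_smul,
    ← intervalIntegral.integral_add (Continuous.intervalIntegrable (by fun_prop) _ _)
      (Continuous.intervalIntegrable (by fun_prop) _ _)]
  refine Eq.trans ?_ hE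
  refine intervalIntegral.integral_congr fun t _ => ?_
  have hR := hD.segmentInverse_right (Real.sin u ^ 2 * Real.sin t ^ 2)
  simp only [(hR.mul_right hR).eq, mul_sub (S - 1), smul_mul_assoc, mul_smul_comm, mul_assoc]
  module

theorem integral_segmentInverse_sq_mul (u : ℝ) :
    (∫ t in (0 : ℝ)..(2 * Real.pi), segmentInverse S (Real.sin u ^ 2 * Real.sin t ^ 2)) *
      (∫ t in (0 : ℝ)..(2 * Real.pi), segmentInverse S (Real.sin u ^ 2 * Real.sin t ^ 2)) *
      (1 + Real.sin u ^ 2 • (S - 1)) = ((2 * Real.pi) ^ 2) • 1 := by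
  have hd : ∀ v : ℝ, HasDerivAt (fun u : ℝ =>
      (∫ t in (0 : ℝ)..(2 * Real.pi), segmentInverse S (Real.sin u ^ 2 * Real.sin t ^ 2)) *
      (∫ t in (0 : ℝ)..(2 * Real.pi), segmentInverse S (Real.sin u ^ 2 * Real.sin t ^ 2)) *
      (1 + Real.sin u ^ 2 • (S - 1))) 0 v := by
    intro v
    have h1 := hasDerivAt_integral_segmentInverse hS v
    have h2 : HasDerivAt (fun u : ℝ => (1 : 𝔄) + Real.sin u ^ 2 • (S - 1))
        ((2 * Real.sin v * Real.cos v) • (S - 1)) v := by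
      simpa using (((Real.hasDerivAt_sin v).pow 2).smul_const (S - 1)).const_add (1 : 𝔄)
    refine ((h1.mul h1).mul h2).congr_deriv ?_
    have hW := integral_deriv_segmentInverse_mul hS v
    have hN : Commute (S - 1) S := (Commute.refl S).sub_left (Commute.one_left S)
    have hNX := Commute.integral_segmentInverse_right hS hN v
    have hDX := Commute.integral_segmentInverse_right hS
      ((Commute.one_left S).add_left (hN.smul_left (Real.sin v ^ 2))) v
    simp only [Pi.mul_apply]
    generalize (∫ t in (0 : ℝ)..(2 * Real.pi),
      segmentInverse S (Real.sin v ^ 2 * Real.sin t ^ 2)) = X at *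
    generalize (∫ t in (0 : ℝ)..(2 * Real.pi),
      (-(2 * Real.sin v * Real.cos v * Real.sin t ^ 2)) •
        ((S - 1) * segmentInverse S (Real.sin v ^ 2 * Real.sin t ^ 2) *
          segmentInverse S (Real.sin v ^ 2 * Real.sin t ^ 2))) = W at *
    generalize 1 + Real.sin v ^ 2 • (S - 1) = D at *
    have hXNX : X * ((S - 1) * X) = (S - 1) * (X * X) := by
      rw [← mul_assoc, ← hNX.eq, mul_assoc]
    rw [add_mul, mul_assoc W, ← hDX.eq, ← mul_assoc, mul_assoc X W, hW, mul_smul_comm,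
      ← (hNX.mul_right hNX).eq, neg_mul, mul_neg, smul_mul_assoc, mul_smul_comm, hXNX,
      mul_assoc (S - 1)]
    module
  have h := is_const_of_deriv_eq_zero (fun v => (hd v).differentiableAt)
    (fun v => (hd v).deriv) u 0
  rw [h]
  simp [segmentInverse, smul_smul, sq]

end segmentInverse

theorem stmt0 {𝔄 : Type*} [NormedRing 𝔄] [NormedAlgebra ℂ 𝔄] [CompleteSpace 𝔄]
    (S : 𝔄) (hS : ∀ z ∈ spectrum ℂ S, ¬(z.im = 0 ∧ z.re ≤ 0)) :
    (∀ t : ℝ, IsUnit ((Real.cos t ^ 2) • (1 : 𝔄) + (Real.sin t ^ 2) • S)) ∧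
    IsUnit S ∧
    invSqrt S * S = S * invSqrt S ∧
    invSqrt S ^ 2 = Ring.inverse S := by
  have hU : ∀ p ∈ Set.Icc (0 : ℝ) 1, IsUnit ((1 : 𝔄) + p • (S - 1)) := fun p hp =>
    isUnit_one_add_smul_sub_one hS hp
  have hSu : IsUnit S := by simpa using hU 1 (by simp)
  have hX : invSqrt S = (2 * Real.pi)⁻¹ • ∫ t in (0 : ℝ)..(2 * Real.pi),
      segmentInverse S (Real.sin (Real.pi / 2) ^ 2 * Real.sin t ^ 2) := by
    simp only [invSqrt, segmentInverse, cos_sq_smul_one_add_sin_sq_smul, Real.sin_pi_div_two,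
      one_pow, one_mul]
  refine ⟨fun t => ?_, hSu, ?_, ?_⟩
  · rw [cos_sq_smul_one_add_sin_sq_smul]
    exact hU _ ⟨by positivity, Real.sin_sq_le_one t⟩
  · rw [hX]
    exact ((Commute.integral_segmentInverse_right hU (Commute.refl S) _).smul_right _).eq.symm
  · have h := integral_segmentInverse_sq_mul hU (Real.pi / 2)
    have h1 : invSqrt S ^ 2 * S = 1 := by
      have hs : 1 + Real.sin (Real.pi / 2) ^ 2 • (S - 1) = S := by simp
      rw [hs] at h
      rw [hX, sq, smul_mul_smul_comm, smul_mul_assoc, h, smul_smul]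
      have : (2 * Real.pi)⁻¹ * (2 * Real.pi)⁻¹ * (2 * Real.pi) ^ 2 = 1 := by
        field_simp
      rw [this, one_smul]
    calc invSqrt S ^ 2 = invSqrt S ^ 2 * S * Ring.inverse S := by
          rw [mul_assoc, Ring.mul_inverse_cancel S hSu, mul_one]
      _ = Ring.inverse S := by rw [h1, one_mul]
end

section
/- Let 𝔄 be a unital complex Banach algebra and let S ∈ 𝔄 have spectrum contained in ℂ ∖ (−∞, 0]. Then X := S^{−1/2} has spectrum contained in the open right half-plane {z ∈ ℂ : Re z > 0}, and X is the unique element of 𝔄 satisfying both (i) X² = S⁻¹ and (ii) the spectrum of X is contained in {z ∈ ℂ : Re z > 0}. -/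
/-- An affine combination `α • 1 + β • X` is invertible when its only candidate zero `-α / β`
avoids the spectrum of `X`. -/
lemma isUnit_smul_one_add_smul {A : Type*} [Ring A] [Algebra ℂ A] {X : A} {α β : ℂ}
    (h0 : β = 0 → α ≠ 0) (h : β ≠ 0 → -α / β ∉ spectrum ℂ X) :
    IsUnit (α • (1 : A) + β • X) := by
  by_cases hβ : β = 0
  · have hα := h0 hβ
    simpa [hβ, Algebra.smul_def] using (IsUnit.mk0 α hα).map (algebraMap ℂ A)
  · have h1 := spectrum.notMem_iff.1 (h hβ)
    have h2 := ((IsUnit.mk0 (-β) (neg_ne_zero.2 hβ)).map (algebraMap ℂ A)).mul h1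
    convert h2 using 1
    rw [Algebra.algebraMap_eq_smul_one, Algebra.algebraMap_eq_smul_one, smul_mul_assoc, one_mul,
      smul_sub, smul_smul]
    rw [show -β * (-α / β) = α by field_simp]
    simp

/-- The elements `cos² t + sin² t · S` are invertible when the spectrum of `S` avoids
`(-∞, 0]`. -/
lemma isUnit_cos_sq_add_sin_sq {A : Type*} [NormedRing A] [NormedAlgebra ℂ A] {S : A}
    (hS : ∀ z ∈ spectrum ℂ S, ¬(z.im = 0 ∧ z.re ≤ 0)) (t : ℝ) :
    IsUnit ((Real.cos t ^ 2) • (1 : A) + (Real.sin t ^ 2) • S) := by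
  have h := isUnit_smul_one_add_smul (X := S) (α := ((Real.cos t ^ 2 : ℝ) : ℂ))
    (β := ((Real.sin t ^ 2 : ℝ) : ℂ)) ?_ ?_
  · simpa only [Complex.coe_smul] using h
  · intro hs hc
    have := Real.sin_sq_add_cos_sq t
    norm_cast at hs hc
    linarith
  · intro _ hmem
    refine hS _ hmem ?_
    rw [← Complex.ofReal_neg, ← Complex.ofReal_div]
    refine ⟨Complex.ofReal_im _, ?_⟩
    rw [Complex.ofReal_re]
    exact div_nonpos_of_nonpos_of_nonneg (by nlinarith [sq_nonneg (Real.cos t)]) (sq_nonneg _)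

/-- `(1 + w) X + (1 - w)` is invertible for `‖w‖ ≤ 1` when the spectrum of `X` lies in the
right half-plane. -/
lemma isUnit_cayley {A : Type*} [Ring A] [Algebra ℂ A] {X : A}
    (hX : ∀ z ∈ spectrum ℂ X, 0 < z.re) {w : ℂ} (hw : ‖w‖ ≤ 1) :
    IsUnit ((1 - w) • (1 : A) + (1 + w) • X) := by
  refine isUnit_smul_one_add_smul ?_ ?_
  · intro h1 h2
    have : (2 : ℂ) = 0 := by linear_combination h1 + h2
    norm_num at this
  · intro h1 hmem
    have h2 := hX _ hmem
    have h3 : 0 < Complex.normSq (1 + w) := Complex.normSq_pos.2 h1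
    have h4 : w.re * w.re + w.im * w.im ≤ 1 := by
      rw [← Complex.normSq_apply, Complex.normSq_eq_norm_sq]
      nlinarith [norm_nonneg w]
    rw [Complex.div_re, ← add_div] at h2
    have h5 := (div_pos_iff_of_pos_right h3).1 h2
    simp at h5
    nlinarith

/-- Partial fraction identity behind the Poisson kernel, for elements commuting with `X`. -/
lemma mul_partial_fraction_eq_one {A : Type*} [Ring A] [Algebra ℂ A] {X S G G' : A} {a b : ℂ}
    (hab : a * b = 1) (hS : S * (X * X) = 1)
    (hG : ((1 - a) • (1 : A) + (1 + a) • X) * G = 1)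
    (hG' : ((1 - b) • (1 : A) + (1 + b) • X) * G' = 1)
    (hG1' : G' * ((1 - b) • (1 : A) + (1 + b) • X) = 1) :
    (((2 + a + b) / 4) • (1 : A) + ((2 - a - b) / 4) • S) * (X * (X + 1) * (G + G') - X) = 1 := by
  set Q := (1 - a) • (1 : A) + (1 + a) • X with hQ
  set Q' := (1 - b) • (1 : A) + (1 + b) • X with hQ'
  set M := ((2 + a + b) / 4) • (1 : A) + ((2 - a - b) / 4) • S with hM
  have hMX : (4 : ℂ) • (M * (X * X)) = Q * Q' := by
    simp only [hM, hQ, hQ', add_mul, mul_add, smul_mul_assoc, mul_smul_comm, hS, one_mul, mul_one]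
    match_scalars <;> first | linear_combination (-1 : ℂ) * hab | linear_combination (2 : ℂ) * hab
  have hlin : (X + 1) * (Q + Q') - Q * Q' = (4 : ℂ) • X := by
    simp only [hQ, hQ', add_mul, mul_add, smul_mul_assoc, mul_smul_comm, one_mul, mul_one]
    match_scalars <;> first | ring1 | linear_combination (2 : ℂ) * hab |
      linear_combination (-1 : ℂ) * hab
  have cXQ : Commute X Q := by
    rw [hQ]
    exact ((Commute.one_right X).smul_right _).add_right ((Commute.refl X).smul_right _)
  have cXQ' : Commute X Q' := by
    rw [hQ']
    exact ((Commute.one_right X).smul_right _).add_right ((Commute.refl X).smul_right _)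
  have hQQ' : Commute Q Q' := by
    rw [hQ]
    exact ((Commute.one_left Q').smul_left _).add_left (cXQ'.smul_left _)
  have hQG' : Commute Q G' := by
    have : Commute Q (Units.mk Q' G' hG' hG1') := hQQ'
    exact this.units_inv_right
  have h1 : Q' * (G' * G) = G := by rw [← mul_assoc, hG', one_mul]
  have h2 : Q * (G' * G) = G' := by rw [← mul_assoc, hQG'.eq, mul_assoc, hG, mul_one]
  have h3 : Q * Q' * (G' * G) = 1 := by rw [mul_assoc, h1, hG]
  have e1 : X * (X + 1) * (G + G') - X = X * ((4 : ℂ) • X) * (G' * G) := by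
    rw [← hlin, mul_assoc X, mul_assoc X, sub_mul, mul_assoc (X + 1), add_mul Q, h1, h2, h3,
      mul_sub, mul_one, add_comm G]
  rw [e1, mul_smul_comm, smul_mul_assoc, mul_smul_comm, ← mul_assoc, ← smul_mul_assoc, hMX, h3]


/-- A square root of `S⁻¹` with spectrum in the right half-plane equals the integral `invSqrt S`. -/
lemma eq_invSqrt_of_sq_eq {A : Type*} [NormedRing A] [NormedAlgebra ℂ A] [CompleteSpace A]
    {S X : A} (hS : ∀ z ∈ spectrum ℂ S, ¬(z.im = 0 ∧ z.re ≤ 0)) (hXS : S * (X * X) = 1)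
    (hX : ∀ z ∈ spectrum ℂ X, 0 < z.re) : X = invSqrt S := by
  let Q : ℂ → A := fun z => (1 - z ^ 2) • (1 : A) + (1 + z ^ 2) • X
  let f : ℂ → A := fun z => Ring.inverse (Q z)
  have hQ : ∀ z : ℂ, ‖z‖ ≤ 1 → IsUnit (Q z) := fun z hz => isUnit_cayley hX (by
    rw [norm_pow]
    exact pow_le_one₀ (norm_nonneg z) hz)
  have hQd : Differentiable ℂ Q := by fun_prop
  have hfd : ∀ z : ℂ, ‖z‖ ≤ 1 → DifferentiableAt ℂ f z := fun z hz =>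
    (differentiableAt_inverse (hQ z hz)).comp z (hQd z)
  have hsphere : ∀ z ∈ Metric.sphere (0 : ℂ) |1|, ‖z‖ = 1 := by simp
  have hf0 : (X + 1) * f 0 = 1 := by
    have := Ring.mul_inverse_cancel _ (hQ 0 (by simp))
    simpa [f, Q, add_comm] using this
  have hmean : Real.circleAverage f 0 1 = f 0 := by
    refine circleAverage_of_differentiable_on_off_countable Set.countable_empty ?_ ?_
    · intro z hz
      exact (hfd z (by simpa using hz)).continuousAt.continuousWithinAt
    · intro z hz
      refine hfd z ?_
      have : ‖z‖ < 1 := by simpa using hz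
      exact this.le
  have hinv : ∀ z : ℂ, ‖z‖ = 1 → ‖z⁻¹‖ = 1 := fun z hz => by simp [hz]
  have hne : ∀ z : ℂ, ‖z‖ = 1 → z ≠ 0 := fun z hz h => by simp [h] at hz
  have hmean' : Real.circleAverage (fun z => f z⁻¹) 0 1 = f 0 := by
    rw [← hmean]
    exact Real.circleAverage_zero_one_congr_inv (f := f)
  have hi : CircleIntegrable f 0 1 := ContinuousOn.circleIntegrable' fun z hz =>
    (hfd z (hsphere z hz).le).continuousAt.continuousWithinAt
  have hi' : CircleIntegrable (fun z => f z⁻¹) 0 1 := ContinuousOn.circleIntegrable' fun z hz =>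
    (ContinuousAt.comp (f := fun z : ℂ => z⁻¹) (g := f)
      (hfd z⁻¹ (hinv z (hsphere z hz)).le).continuousAt
      (continuousAt_inv₀ (hne z (hsphere z hz)))).continuousWithinAt
  have hint : ∀ t : ℝ, Ring.inverse ((Real.cos t ^ 2) • (1 : A) + (Real.sin t ^ 2) • S) =
      X * (X + 1) * (f (circleMap 0 1 t) + f (circleMap 0 1 t)⁻¹) - X := by
    intro t
    set z := circleMap 0 1 t with hz
    have hzn : ‖z‖ = 1 := by simp [hz]
    have hz1 : z = Complex.cos t + Complex.sin t * Complex.I := by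
      simp [hz, circleMap, Complex.exp_mul_I]
    have hz2 : z⁻¹ = Complex.cos t - Complex.sin t * Complex.I := by
      rw [Complex.cos_sub_sin_I]
      simp [hz, circleMap, ← Complex.exp_neg]
    have hcs := Complex.sin_sq_add_cos_sq t
    have key := mul_partial_fraction_eq_one (a := z ^ 2) (b := z⁻¹ ^ 2)
      (by rw [← mul_pow, mul_inv_cancel₀ (hne z hzn), one_pow]) hXS
      (Ring.mul_inverse_cancel _ (hQ z hzn.le))
      (Ring.mul_inverse_cancel _ (hQ z⁻¹ (hinv z hzn).le))
      (Ring.inverse_mul_cancel _ (hQ z⁻¹ (hinv z hzn).le))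
    rw [show (2 + z ^ 2 + z⁻¹ ^ 2) / 4 = ((Real.cos t ^ 2 : ℝ) : ℂ) by
        rw [hz2, hz1]; push_cast
        linear_combination (-1 / 2 : ℂ) * hcs + (Complex.sin t ^ 2 / 2) * Complex.I_sq,
      show (2 - z ^ 2 - z⁻¹ ^ 2) / 4 = ((Real.sin t ^ 2 : ℝ) : ℂ) by
        rw [hz2, hz1]; push_cast
        linear_combination (-1 / 2 : ℂ) * hcs - (Complex.sin t ^ 2 / 2) * Complex.I_sq,
      Complex.coe_smul, Complex.coe_smul] at key
    have hu := isUnit_cos_sq_add_sin_sq hS t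
    have := Ring.inverse_mul_cancel_left _ (X * (X + 1) * (f z + f z⁻¹) - X) hu
    rw [← this]
    exact (mul_one _).symm.trans (congrArg _ key.symm)
  have hE : invSqrt S = Real.circleAverage
      (fun z => X * (X + 1) * (f z + f z⁻¹) - X) 0 1 := by
    simp only [invSqrt, Real.circleAverage, hint]
  have hsum : CircleIntegrable (fun z => f z + f z⁻¹) 0 1 := hi.add hi'
  have hmul := (ContinuousLinearMap.mul ℝ A (X * (X + 1))).circleAverage_comp_comm hsum
  have hmuli : CircleIntegrable (fun z => X * (X + 1) * (f z + f z⁻¹)) 0 1 :=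
    ⟨(ContinuousLinearMap.mul ℝ A (X * (X + 1))).integrable_comp hsum.1,
      (ContinuousLinearMap.mul ℝ A (X * (X + 1))).integrable_comp hsum.2⟩
  rw [hE, Real.circleAverage_fun_sub hmuli (circleIntegrable_const _ _ _),
    Real.circleAverage_const]
  rw [Real.circleAverage_fun_add hi hi', hmean, hmean'] at hmul
  have hmul' : Real.circleAverage (fun z => X * (X + 1) * (f z + f z⁻¹)) 0 1 =
    X * (X + 1) * (f 0 + f 0) := hmul
  rw [hmul', mul_assoc, mul_add, hf0]
  noncomm_ring

/-- In a commutative Banach algebra, `S⁻¹` has a square root with spectrum in the right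
half-plane, obtained as the exponential of `-1/2` times a logarithm of `S`. -/
lemma exists_sq_mul_eq_one_of_comm {A : Type*} [NormedCommRing A] [NormedAlgebra ℂ A]
    [CompleteSpace A] {S : A} (hS : ∀ z ∈ spectrum ℂ S, ¬(z.im = 0 ∧ z.re ≤ 0)) :
    ∃ Y : A, S * (Y * Y) = 1 ∧ ∀ z ∈ spectrum ℂ Y, 0 < z.re := by
  let _ : NormedAlgebra ℚ A := NormedAlgebra.restrictScalars ℚ ℂ A
  let M : ℝ → A := fun t => (Real.cos t ^ 2) • (1 : A) + (Real.sin t ^ 2) • S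
  let M' : ℝ → A := fun t => (2 * Real.sin t * Real.cos t) • (S - 1)
  have hMu : ∀ t, IsUnit (M t) := isUnit_cos_sq_add_sin_sq hS
  have hM : ∀ t, HasDerivAt M (M' t) t := by
    intro t
    have h1 := (((Real.hasDerivAt_cos t).pow 2).smul_const (1 : A)).add
      (((Real.hasDerivAt_sin t).pow 2).smul_const S)
    refine h1.congr_deriv ?_
    simp only [M', smul_sub]
    match_scalars <;> ring
  have hMc : Continuous M := continuous_iff_continuousAt.2 fun t => (hM t).continuousAt
  have hM'c : Continuous M' := by fun_prop
  have hIc : Continuous fun t => Ring.inverse (M t) := continuous_iff_continuousAt.2 fun t =>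
    ContinuousAt.comp (g := Ring.inverse) (differentiableAt_inverse (𝕜 := ℂ) (hMu t)).continuousAt
      hMc.continuousAt
  let g : ℝ → A := fun t => M' t * Ring.inverse (M t)
  have hgc : Continuous g := hM'c.mul hIc
  let L : ℝ → A := fun t => ∫ u in (0 : ℝ)..t, g u
  have hL : ∀ t, HasDerivAt L (g t) t := fun t => (hgc.integral_hasStrictDerivAt 0 t).hasDerivAt
  have hL0 : L 0 = 0 := intervalIntegral.integral_same
  have hM0 : M 0 = 1 := by simp [M]
  have hM1 : M (Real.pi / 2) = S := by simp [M]
  have hexp : ∀ t, NormedSpace.exp (-L t) * M t = 1 := by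
    have hd : ∀ t, HasDerivAt (fun t => NormedSpace.exp (-L t) * M t) 0 t := by
      intro t
      have h1 : HasDerivAt (fun t => NormedSpace.exp (-L t)) _ t :=
        (hasFDerivAt_exp (𝕂 := ℝ) (x := -L t)).comp_hasDerivAt t (hL t).neg
      refine (h1.mul (hM t)).congr_deriv ?_
      have h2 := Ring.inverse_mul_cancel _ (hMu t)
      simp only [g, smul_apply, one_apply_eq_self, smul_eq_mul]
      linear_combination (-NormedSpace.exp (-L t) * M' t) * h2
    intro t
    have := is_const_of_deriv_eq_zero (fun t => (hd t).differentiableAt) (fun t => (hd t).deriv) t 0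
    rw [this, hL0, hM0, neg_zero, NormedSpace.exp_zero, one_mul]
  refine ⟨NormedSpace.exp ((-(1 / 2) : ℂ) • L (Real.pi / 2)), ?_, ?_⟩
  · rw [← NormedSpace.exp_add, ← add_smul]
    have := hexp (Real.pi / 2)
    rw [hM1, mul_comm] at this
    convert this using 3
    norm_num
  · intro z hz
    obtain ⟨φ, rfl⟩ := WeakDual.CharacterSpace.mem_spectrum_iff_exists.1 hz
    have hφS := hS _ (AlgHom.apply_mem_spectrum φ S)
    let Φ : A →L[ℝ] ℂ := (WeakDual.toStrongDual (φ : WeakDual ℂ A)).restrictScalars ℝ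
    have hΦ : ∀ a, Φ a = φ a := fun a => rfl
    have hφc : Continuous φ := Φ.continuous
    have hφM : ∀ t, φ (M t) ∈ Complex.slitPlane := by
      intro t
      have hφM : φ (M t) = Real.cos t ^ 2 • (1 : ℂ) + Real.sin t ^ 2 • φ S := by
        rw [← hΦ, map_add, map_smul, map_smul, hΦ, hΦ, map_one]
      have hre : (φ (M t)).re = Real.cos t ^ 2 + Real.sin t ^ 2 * (φ S).re := by
        rw [hφM]
        simp only [Complex.add_re, Complex.smul_re, Complex.one_re, smul_eq_mul, mul_one]
      have him : (φ (M t)).im = Real.sin t ^ 2 * (φ S).im := by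
        rw [hφM]
        simp only [Complex.add_im, Complex.smul_im, Complex.one_im, smul_eq_mul, mul_zero,
          zero_add]
      have hcs := Real.sin_sq_add_cos_sq t
      rw [Complex.mem_slitPlane_iff, hre, him]
      by_contra! h
      obtain ⟨h1, h2⟩ := h
      rcases mul_eq_zero.1 h2 with h3 | h3
      · rw [h3] at h1 hcs
        linarith
      · have h4 : 0 < (φ S).re := not_le.1 fun h => hφS ⟨h3, h⟩
        have h5 := mul_nonneg (sq_nonneg (Real.sin t)) h4.le
        have h6 : Real.sin t ^ 2 = 1 := by linarith [sq_nonneg (Real.cos t)]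
        rw [h6] at h1
        linarith [sq_nonneg (Real.cos t)]
    have hlog : ∀ t, φ (L t) = Complex.log (φ (M t)) := by
      have hd : ∀ t, HasDerivAt (fun t => φ (L t) - Complex.log (φ (M t))) 0 t := by
        intro t
        have h1 : HasDerivAt (fun t => φ (L t)) (φ (g t)) t := Φ.hasFDerivAt.comp_hasDerivAt t (hL t)
        have h2 : HasDerivAt (fun t => φ (M t)) (φ (M' t)) t :=
          Φ.hasFDerivAt.comp_hasDerivAt t (hM t)
        refine (h1.sub (h2.clog_real (hφM t))).congr_deriv ?_
        have h3 := congrArg φ (Ring.inverse_mul_cancel _ (hMu t))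
        have h4 := Complex.slitPlane_ne_zero (hφM t)
        rw [map_mul, map_one] at h3
        simp only [g, map_mul]
        field_simp
        linear_combination (φ (M' t)) * h3
      intro t
      have := is_const_of_deriv_eq_zero (fun t => (hd t).differentiableAt)
        (fun t => (hd t).deriv) t 0
      rw [hL0, hM0, map_zero, map_one, Complex.log_one, sub_zero] at this
      exact sub_eq_zero.1 this
    rw [NormedSpace.map_exp φ hφc, map_smul, hlog, hM1, ← Complex.exp_eq_exp_ℂ, Complex.exp_re]
    have hmem := hφM (Real.pi / 2)
    rw [hM1] at hmem
    refine mul_pos (Real.exp_pos _) (Real.cos_pos_of_mem_Ioo ?_)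
    have h1 := Complex.neg_pi_lt_arg (φ S)
    have h2 := lt_of_le_of_ne (Complex.arg_le_pi (φ S)) (Complex.slitPlane_arg_ne_pi hmem)
    have h3 : ((-(1 / 2) : ℂ) • Complex.log (φ S)).im = -(1 / 2) * (φ S).arg := by
      simp [Complex.mul_im, Complex.log_im]
    rw [h3]
    constructor <;> linarith

open Subalgebra in
/-- `S⁻¹` has a square root with spectrum in the right half-plane when the spectrum of `S` avoids
`(-∞, 0]`. -/
lemma exists_sq_mul_eq_one {A : Type*} [NormedRing A] [NormedAlgebra ℂ A] [CompleteSpace A]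
    {S : A} (hS : ∀ z ∈ spectrum ℂ S, ¬(z.im = 0 ∧ z.re ≤ 0)) :
    ∃ Y : A, S * (Y * Y) = 1 ∧ ∀ z ∈ spectrum ℂ Y, 0 < z.re := by
  let B : Subalgebra ℂ A := centralizer ℂ (centralizer ℂ {S} : Set A)
  have hB : ∀ {x : A}, x ∈ B ↔ ∀ y, Commute S y → Commute y x := by
    intro x
    simp only [B, mem_centralizer_iff, SetLike.mem_coe, Set.mem_singleton_iff, forall_eq]
    rfl
  have hSB : S ∈ B := hB.2 fun y hy => hy.symm
  have hcomm : ∀ x y : B, x * y = y * x := fun x y =>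
    Subtype.ext (hB.1 y.2 x (hB.1 x.2 S (Commute.refl S)))
  let _ : NormedCommRing B := { (inferInstance : NormedRing B) with mul_comm := hcomm }
  have hclosed : IsClosed (B : Set A) := Set.isClosed_centralizer _
  have : CompleteSpace B := hclosed.completeSpace_coe
  have hspec : spectrum ℂ (⟨S, hSB⟩ : B) ⊆ spectrum ℂ S := by
    intro z hz hu
    apply hz
    obtain ⟨u, hu⟩ := hu
    have hinv : ((u⁻¹ : Aˣ) : A) ∈ B := hB.2 fun y hy => by
      refine Commute.units_inv_right ?_
      rw [hu]
      exact Commute.sub_right (Algebra.commutes z y).symm hy.symm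
    refine IsUnit.of_mul_eq_one ⟨_, hinv⟩ (Subtype.ext ?_)
    have := u.mul_inv
    rwa [hu] at this
  obtain ⟨Y, hY, hYs⟩ := exists_sq_mul_eq_one_of_comm fun z hz => hS z (hspec hz)
  refine ⟨Y, congrArg Subtype.val hY, fun z hz => hYs z ?_⟩
  exact AlgHom.spectrum_apply_subset B.val Y hz

theorem stmt1 {𝔄 : Type*} [NormedRing 𝔄] [NormedAlgebra ℂ 𝔄] [CompleteSpace 𝔄]
    (S : 𝔄) (hS : ∀ z ∈ spectrum ℂ S, ¬(z.im = 0 ∧ z.re ≤ 0)) :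
    (∀ z ∈ spectrum ℂ (invSqrt S), 0 < z.re) ∧
    invSqrt S ^ 2 = Ring.inverse S ∧
    ∀ X : 𝔄, X ^ 2 = Ring.inverse S → (∀ z ∈ spectrum ℂ X, 0 < z.re) → X = invSqrt S := by
  have hu : IsUnit S := by simpa using isUnit_cos_sq_add_sin_sq hS (Real.pi / 2)
  obtain ⟨Y, hY, hYs⟩ := exists_sq_mul_eq_one hS
  rw [← eq_invSqrt_of_sq_eq hS hY hYs]
  refine ⟨hYs, ?_, fun X hX hXs => ?_⟩
  · rw [sq, ← mul_one (Ring.inverse S), ← hY, Ring.inverse_mul_cancel_left _ _ hu]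
  · rw [eq_invSqrt_of_sq_eq hS hY hYs]
    refine eq_invSqrt_of_sq_eq hS ?_ hXs
    rw [← sq, hX, Ring.mul_inverse_cancel _ hu]
end

section
/- Let 𝔄 be a unital complex Banach algebra and let H ∈ 𝔄 have spectrum disjoint from ℝ. Then the spectrum of −H² is contained in ℂ ∖ (−∞, 0], and the two definitions of the polarization agree: (1/2π)∫₀^{2π} ((−sin t)·1 + (cos t)·H)·((cos t)·1 + (sin t)·H)⁻¹ dt = H·(−H²)^{−1/2} = (1/2π)∫₀^{2π} H·((cos²t)·1 − (sin²t)·H²)⁻¹ dt. -/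
/-- The polarization `pol H := (1/(2π)) ∫₀^{2π} ((−sin t)·1 + (cos t)·H)·((cos t)·1 + (sin t)·H)⁻¹ dt`
in a unital complex Banach algebra. -/
noncomputable def pol {𝔄 : Type*} [NormedRing 𝔄] [NormedAlgebra ℂ 𝔄] [CompleteSpace 𝔄]
    (H : 𝔄) : 𝔄 :=
  (2 * Real.pi)⁻¹ • ∫ t in (0:ℝ)..(2 * Real.pi),
    ((-Real.sin t) • (1 : 𝔄) + (Real.cos t) • H) *
      Ring.inverse ((Real.cos t) • (1 : 𝔄) + (Real.sin t) • H)

theorem isUnit_real_smul_one_add_smul {𝔄 : Type*} [NormedRing 𝔄] [NormedAlgebra ℂ 𝔄]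
    {H : 𝔄} (hH : ∀ z ∈ spectrum ℂ H, z.im ≠ 0) (a b : ℝ) (hab : a ≠ 0 ∨ b ≠ 0) :
    IsUnit (a • (1 : 𝔄) + b • H) := by
  rcases eq_or_ne b 0 with rfl | hb
  · have ha : a ≠ 0 := by simpa using hab
    simpa using (isUnit_one (M := 𝔄)).smul (Units.mk0 a ha)
  · have hz : ((-(a / b) : ℝ) : ℂ) ∉ spectrum ℂ H := fun h => hH _ h (Complex.ofReal_im _)
    have hu := (spectrum.notMem_iff.1 hz).smul (Units.mk0 (-b) (neg_ne_zero.2 hb))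
    convert hu using 1
    rw [Algebra.algebraMap_eq_smul_one, Complex.coe_smul, Units.smul_mk0, smul_sub, smul_smul]
    rw [neg_mul_neg, mul_div_cancel₀ a hb, neg_smul, sub_neg_eq_add]

theorem isUnit_cos_smul_one_add_sin_smul {𝔄 : Type*} [NormedRing 𝔄] [NormedAlgebra ℂ 𝔄]
    {H : 𝔄} (hH : ∀ z ∈ spectrum ℂ H, z.im ≠ 0) (t : ℝ) :
    IsUnit (Real.cos t • (1 : 𝔄) + Real.sin t • H) := by
  refine isUnit_real_smul_one_add_smul hH _ _ ?_
  by_contra! h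
  simpa [h.1, h.2] using Real.sin_sq_add_cos_sq t

theorem mul_smul_one_add_neg_smul {𝔄 : Type*} [NormedRing 𝔄] [NormedAlgebra ℂ 𝔄]
    (H : 𝔄) (c s : ℝ) :
    (c • (1 : 𝔄) + s • H) * (c • (1 : 𝔄) + (-s) • H) = c ^ 2 • (1 : 𝔄) - s ^ 2 • H ^ 2 := by
  simp only [add_mul, mul_add, smul_mul_assoc, mul_smul_comm, one_mul, mul_one, ← pow_two]
  module

theorem polarization_integrand_add_neg {𝔄 : Type*} [NormedRing 𝔄] [NormedAlgebra ℂ 𝔄]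
    (H : 𝔄) (c s : ℝ) (hcs : c ^ 2 + s ^ 2 = 1)
    (hp : IsUnit (c • (1 : 𝔄) + s • H)) (hm : IsUnit (c • (1 : 𝔄) + (-s) • H)) :
    ((-s) • (1 : 𝔄) + c • H) * Ring.inverse (c • (1 : 𝔄) + s • H) +
      (s • (1 : 𝔄) + c • H) * Ring.inverse (c • (1 : 𝔄) + (-s) • H) =
    (2 : ℝ) • (H * Ring.inverse (c ^ 2 • (1 : 𝔄) - s ^ 2 • H ^ 2)) := by
  have hprod := mul_smul_one_add_neg_smul H c s
  have hprod' : (c • (1 : 𝔄) + (-s) • H) * (c • (1 : 𝔄) + s • H) =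
      c ^ 2 • (1 : 𝔄) - s ^ 2 • H ^ 2 := by
    simpa using mul_smul_one_add_neg_smul H c (-s)
  have hu : IsUnit (c ^ 2 • (1 : 𝔄) - s ^ 2 • H ^ 2) := hprod ▸ hp.mul hm
  refine hu.mul_right_cancel ?_
  rw [smul_mul_assoc, Ring.inverse_mul_cancel_right _ _ hu, add_mul]
  nth_rewrite 1 [← hprod]
  rw [← hprod', ← mul_assoc, ← mul_assoc, Ring.inverse_mul_cancel_right _ _ hp,
    Ring.inverse_mul_cancel_right _ _ hm]
  have key : ((-s) • (1 : 𝔄) + c • H) * (c • (1 : 𝔄) + (-s) • H) +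
      (s • (1 : 𝔄) + c • H) * (c • (1 : 𝔄) + s • H) = (2 * (c ^ 2 + s ^ 2)) • H := by
    simp only [add_mul, mul_add, smul_mul_assoc, mul_smul_comm, one_mul, mul_one]
    module
  rw [key, hcs, mul_one]

theorem Continuous.ringInverse {X 𝔄 : Type*} [TopologicalSpace X] [NormedRing 𝔄]
    [HasSummableGeomSeries 𝔄] {f : X → 𝔄} (hf : Continuous f) (hu : ∀ x, IsUnit (f x)) :
    Continuous fun x => Ring.inverse (f x) := by
  refine continuous_iff_continuousAt.2 fun x => ?_
  obtain ⟨u, hu⟩ := hu x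
  exact ContinuousAt.comp (f := f) (hu ▸ NormedRing.inverse_continuousAt u) hf.continuousAt

theorem integral_polarization_integrand {𝔄 : Type*} [NormedRing 𝔄] [NormedAlgebra ℂ 𝔄]
    [CompleteSpace 𝔄] {H : 𝔄} (hH : ∀ z ∈ spectrum ℂ H, z.im ≠ 0) :
    ∫ t in (0:ℝ)..(2 * Real.pi), ((-Real.sin t) • (1 : 𝔄) + Real.cos t • H) *
      Ring.inverse (Real.cos t • (1 : 𝔄) + Real.sin t • H) =
    ∫ t in (0:ℝ)..(2 * Real.pi),
      H * Ring.inverse (Real.cos t ^ 2 • (1 : 𝔄) - Real.sin t ^ 2 • H ^ 2) := by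
  set f : ℝ → 𝔄 := fun t => ((-Real.sin t) • (1 : 𝔄) + Real.cos t • H) *
    Ring.inverse (Real.cos t • (1 : 𝔄) + Real.sin t • H) with hf
  have hcont : Continuous f :=
    Continuous.mul (by fun_prop)
      (Continuous.ringInverse (by fun_prop) (isUnit_cos_smul_one_add_sin_smul hH))
  have hrefl : ∫ t in (0:ℝ)..(2 * Real.pi), f (2 * Real.pi - t) =
      ∫ t in (0:ℝ)..(2 * Real.pi), f t := by
    simp
  have hadd (t : ℝ) : f t + f (2 * Real.pi - t) =
      (2 : ℝ) • (H * Ring.inverse (Real.cos t ^ 2 • (1 : 𝔄) - Real.sin t ^ 2 • H ^ 2)) := by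
    have hm := isUnit_cos_smul_one_add_sin_smul hH (-t)
    rw [Real.cos_neg, Real.sin_neg] at hm
    rw [← polarization_integrand_add_neg H _ _ (Real.cos_sq_add_sin_sq t)
      (isUnit_cos_smul_one_add_sin_smul hH t) hm]
    simp only [hf, Real.cos_two_pi_sub, Real.sin_two_pi_sub, neg_neg]
  have hsum := intervalIntegral.integral_add (μ := MeasureTheory.volume)
    (hcont.intervalIntegrable 0 (2 * Real.pi))
    ((hcont.comp (continuous_sub_left (2 * Real.pi))).intervalIntegrable 0 (2 * Real.pi))
  simp only [Function.comp_apply, hadd] at hsum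
  rw [intervalIntegral.integral_smul, hrefl, ← two_smul ℝ] at hsum
  exact smul_right_injective 𝔄 (two_ne_zero' ℝ) hsum.symm

theorem stmt3 {𝔄 : Type*} [NormedRing 𝔄] [NormedAlgebra ℂ 𝔄] [CompleteSpace 𝔄]
    (H : 𝔄) (hH : ∀ z ∈ spectrum ℂ H, z.im ≠ 0) :
    (∀ z ∈ spectrum ℂ (-(H ^ 2)), ¬(z.im = 0 ∧ z.re ≤ 0)) ∧
    pol H = H * invSqrt (-(H ^ 2)) ∧
    pol H = (2 * Real.pi)⁻¹ • ∫ t in (0:ℝ)..(2 * Real.pi),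
      H * Ring.inverse ((Real.cos t ^ 2) • (1 : 𝔄) - (Real.sin t ^ 2) • (H ^ 2)) := by
  have hpol : pol H = (2 * Real.pi)⁻¹ • ∫ t in (0:ℝ)..(2 * Real.pi),
      H * Ring.inverse ((Real.cos t ^ 2) • (1 : 𝔄) - (Real.sin t ^ 2) • (H ^ 2)) :=
    congrArg _ (integral_polarization_integrand hH)
  refine ⟨?_, ?_, hpol⟩
  · rintro z hz ⟨him, hre⟩
    refine hz ?_
    have hr : √(-z.re) ^ 2 = -z.re := Real.sq_sqrt (neg_nonneg.2 hre)
    have hzre : z = (z.re : ℂ) := Complex.ext rfl him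
    have hp := isUnit_real_smul_one_add_smul hH (√(-z.re)) 1 (Or.inr one_ne_zero)
    have hm := isUnit_real_smul_one_add_smul hH (√(-z.re)) (-1) (Or.inr (by norm_num))
    have h := (hp.mul hm).neg
    rw [mul_smul_one_add_neg_smul, hr] at h
    rw [spectrum.mem_resolventSet_iff]
    convert h using 1
    rw [hzre, Algebra.algebraMap_eq_smul_one, Complex.coe_smul, Complex.ofReal_re]
    module
  · have hunit (t : ℝ) : IsUnit ((Real.cos t ^ 2) • (1 : 𝔄) - (Real.sin t ^ 2) • H ^ 2) := by
      have hm := isUnit_cos_smul_one_add_sin_smul hH (-t)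
      rw [Real.cos_neg, Real.sin_neg] at hm
      exact mul_smul_one_add_neg_smul H _ _ ▸ (isUnit_cos_smul_one_add_sin_smul hH t).mul hm
    have hcont := Continuous.ringInverse (by fun_prop) hunit
    rw [hpol, invSqrt, mul_smul_comm]
    simp only [smul_neg, ← sub_eq_add_neg]
    exact congrArg _ ((ContinuousLinearMap.mul ℝ 𝔄 H).intervalIntegral_comp_comm
      (hcont.intervalIntegrable _ _))
end

section
/- Let 𝔄 be a unital complex Banach algebra and let H ∈ 𝔄 have spectrum disjoint from ℝ. Then for Q ∈ 𝔄 one has Q = pol H if and only if the following three conditions hold: (i) Q² = −1; (ii) H commutes with Q; (iii) the spectrum of H·Q⁻¹ (where Q⁻¹ = −Q) is contained in the open right half-plane {z ∈ ℂ : Re z > 0}. -/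
open MeasureTheory Real

section Rotation

variable {A : Type*} [NormedRing A] [NormedAlgebra ℂ A]

theorem isUnit_cos_add_sin_smul {H : A} (hH : ∀ z ∈ spectrum ℂ H, z.im ≠ 0) (t : ℝ) :
    IsUnit (cos t • (1 : A) + sin t • H) := by
  by_cases hs : sin t = 0
  · have hc : cos t ≠ 0 := fun hc ↦ by
      simpa [hs, hc] using sin_sq_add_cos_sq t
    simpa [hs, Units.smul_def] using (isUnit_one (M := A)).smul (Units.mk0 (cos t) hc)
  · have hz : ((-(cos t / sin t) : ℝ) : ℂ) ∉ spectrum ℂ H := fun h ↦ hH _ h (Complex.ofReal_im _)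
    have hu := (spectrum.notMem_iff.mp hz).smul (Units.mk0 (-sin t) (neg_ne_zero.mpr hs))
    have hcoe (r : ℝ) : algebraMap ℂ A r = r • (1 : A) := by
      rw [Algebra.algebraMap_eq_smul_one, Complex.coe_smul]
    convert hu using 1
    rw [hcoe, Units.smul_def, Units.val_mk0, smul_sub, smul_smul]
    have : -sin t * -(cos t / sin t) = cos t := by field_simp
    rw [this]
    module

/-- The integrand `t ↦ (−sin t + cos t H) (cos t + sin t H)⁻¹` of `pol H`. -/
noncomputable def polIntegrand (H : A) (t : ℝ) : A :=
  ((-sin t) • (1 : A) + cos t • H) * Ring.inverse (cos t • (1 : A) + sin t • H)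

theorem polIntegrand_periodic (H : A) : Function.Periodic (polIntegrand H) (2 * π) := by
  intro t
  simp [polIntegrand]

theorem continuous_polIntegrand [CompleteSpace A] {H : A}
    (hH : ∀ z ∈ spectrum ℂ H, z.im ≠ 0) : Continuous (polIntegrand H) := by
  refine Continuous.mul (by fun_prop) (continuous_iff_continuousAt.mpr fun t ↦ ?_)
  obtain ⟨u, hu⟩ := isUnit_cos_add_sin_smul hH t
  have hinv := NormedRing.inverse_continuousAt u
  rw [hu] at hinv
  exact ContinuousAt.comp (f := fun t : ℝ ↦ cos t • (1 : A) + sin t • H) hinv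
    (by fun_prop)

theorem pol_eq [CompleteSpace A] (H : A) :
    pol H = (2 * π)⁻¹ • ∫ t in (0 : ℝ)..(2 * π), polIntegrand H t := rfl

theorem intervalIntegral_polIntegrand [CompleteSpace A] (H : A) :
    ∫ t in (0 : ℝ)..(2 * π), polIntegrand H t = (2 * π) • pol H := by
  rw [pol_eq, smul_inv_smul₀ (by positivity)]

theorem AlgHom.map_ringInverse {R M N : Type*} [CommSemiring R] [Semiring M] [Semiring N]
    [Algebra R M] [Algebra R N] (f : M →ₐ[R] N) {a : M} (ha : IsUnit a) :
    f (Ring.inverse a) = Ring.inverse (f a) := by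
  obtain ⟨u, rfl⟩ := ha
  rw [Ring.inverse_unit]
  exact (Ring.inverse_unit (Units.map (f : M →* N) u)).symm

/-- Polarization commutes with continuous algebra homomorphisms. -/
theorem AlgHom.map_pol {B : Type*} [CompleteSpace A] [NormedRing B] [NormedAlgebra ℂ B]
    [CompleteSpace B] (f : A →ₐ[ℂ] B) (hf : Continuous f) {H : A}
    (hH : ∀ z ∈ spectrum ℂ H, z.im ≠ 0) : f (pol H) = pol (f H) := by
  have hsmul (r : ℝ) (a : A) : f (r • a) = r • f a := by
    rw [← Complex.coe_smul, map_smul, Complex.coe_smul]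
  let L : A →L[ℂ] B := ⟨f.toLinearMap, hf⟩
  have hL := L.intervalIntegral_comp_comm
    ((continuous_polIntegrand hH).intervalIntegrable (μ := volume) 0 (2 * π))
  rw [pol_eq, pol_eq, hsmul]
  congr 1
  refine hL.symm.trans (intervalIntegral.integral_congr fun t _ ↦ ?_)
  change f (polIntegrand H t) = polIntegrand (f H) t
  simp only [polIntegrand, map_mul, map_add, hsmul, map_one,
    f.map_ringInverse (isUnit_cos_add_sin_smul hH t)]

theorem commute_pol [CompleteSpace A] {H x : A} (hH : ∀ z ∈ spectrum ℂ H, z.im ≠ 0)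
    (hx : Commute x H) : Commute x (pol H) := by
  have hcomm (t : ℝ) : Commute x (polIntegrand H t) := by
    have hc (a b : ℝ) : Commute x (a • (1 : A) + b • H) :=
      ((Commute.one_right x).smul_right a).add_right (hx.smul_right b)
    refine (hc _ _).mul_right ?_
    obtain ⟨u, hu⟩ := isUnit_cos_add_sin_smul hH t
    have hxu : Commute x u := hu ▸ hc _ _
    rw [← hu, Ring.inverse_unit]
    exact hxu.units_inv_right
  have hint := (continuous_polIntegrand hH).intervalIntegrable (μ := volume) 0 (2 * π)
  have hl := (ContinuousLinearMap.mul ℂ A x).intervalIntegral_comp_comm hint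
  have hr := ((ContinuousLinearMap.mul ℂ A).flip x).intervalIntegral_comp_comm hint
  simp only [ContinuousLinearMap.mul_apply', ContinuousLinearMap.flip_apply] at hl hr
  rw [pol_eq]
  refine Commute.smul_right ?_ _
  rw [commute_iff_eq, ← hl, ← hr]
  exact intervalIntegral.integral_congr fun t _ ↦ hcomm t

end Rotation

section Commutative

variable {B : Type*} [NormedCommRing B] [NormedAlgebra ℂ B]

/-- The addition formula relating two values of the integrand of `pol H`, the analogue of the one
for the cotangent. -/
theorem sin_smul_one_add_polIntegrand_mul {H : B} (hH : ∀ z ∈ spectrum ℂ H, z.im ≠ 0)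
    (t u : ℝ) :
    sin u • (1 + polIntegrand H t * polIntegrand H (t + u)) =
      cos u • (polIntegrand H t - polIntegrand H (t + u)) := by
  have h₁ := Ring.mul_inverse_cancel _ (isUnit_cos_add_sin_smul hH t)
  have h₂ := Ring.mul_inverse_cancel _ (isUnit_cos_add_sin_smul hH (t + u))
  unfold polIntegrand
  generalize Ring.inverse (cos t • (1 : B) + sin t • H) = a at *
  generalize Ring.inverse (cos (t + u) • (1 : B) + sin (t + u) • H) = b at *
  simp only [cos_add, sin_add, Algebra.smul_def, map_add, map_sub, map_mul, map_neg, mul_one]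
    at h₁ h₂ ⊢
  generalize algebraMap ℝ B (cos t) = c at *
  generalize algebraMap ℝ B (sin t) = s at *
  generalize algebraMap ℝ B (cos u) = p at *
  generalize algebraMap ℝ B (sin u) = q at *
  linear_combination (-q * ((c * p - s * q) + (s * p + c * q) * H) * b
      - p * (-(s * p + c * q) + (c * p - s * q) * H) * b) * h₁
    + (-q + p * (-s + c * H) * a) * h₂

/-- `pol H` squares to `-1`: integrate the addition formula over the torus. -/
theorem pol_sq [CompleteSpace B] {H : B} (hH : ∀ z ∈ spectrum ℂ H, z.im ≠ 0) :
    pol H ^ 2 = -1 := by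
  have hcont := continuous_polIntegrand hH
  have hshift (u : ℝ) : ∫ t in (0 : ℝ)..(2 * π), polIntegrand H (t + u) = (2 * π) • pol H := by
    rw [intervalIntegral.integral_comp_add_right, zero_add, add_comm,
      (polIntegrand_periodic H).intervalIntegral_add_eq u 0, zero_add,
      intervalIntegral_polIntegrand]
  have hcorr : ∀ᵐ u : ℝ, ∫ t in (0 : ℝ)..(2 * π), polIntegrand H t * polIntegrand H (t + u) =
      (-(2 * π)) • (1 : B) := by
    have hzero : {u : ℝ | sin u = 0}.Countable :=
      (Set.countable_range fun n : ℤ ↦ n * π).mono fun u hu ↦ sin_eq_zero_iff.mp hu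
    filter_upwards [hzero.ae_notMem volume] with u hu
    have hint : ∫ t in (0 : ℝ)..(2 * π),
        sin u • (1 + polIntegrand H t * polIntegrand H (t + u)) = 0 := by
      simp_rw [sin_smul_one_add_polIntegrand_mul hH]
      rw [intervalIntegral.integral_smul, intervalIntegral.integral_sub
        (hcont.intervalIntegrable _ _) (Continuous.intervalIntegrable (by fun_prop) _ _),
        hshift, intervalIntegral_polIntegrand, sub_self, smul_zero]
    rw [intervalIntegral.integral_smul, smul_eq_zero_iff_right hu,
      intervalIntegral.integral_add (by simp) (Continuous.intervalIntegrable (by fun_prop) _ _),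
      intervalIntegral.integral_const, sub_zero] at hint
    rw [neg_smul]
    exact eq_neg_of_add_eq_zero_right hint
  have hmul (x : B) {f : ℝ → B} (hf : Continuous f) :
      ∫ t in (0 : ℝ)..(2 * π), x * f t = x * ∫ t in (0 : ℝ)..(2 * π), f t :=
    (ContinuousLinearMap.mul ℂ B x).intervalIntegral_comp_comm (hf.intervalIntegrable _ _)
  have hswap := intervalIntegral_intervalIntegral_swap (a := 0) (b := 2 * π) (c := 0)
    (d := 2 * π) (F := fun t u ↦ polIntegrand H t * polIntegrand H (t + u))
    (((show Continuous _ by fun_prop).continuousOn.integrableOn_compact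
      (isCompact_uIcc.prod isCompact_uIcc)).mono_set
      (Set.prod_mono Set.uIoc_subset_uIcc Set.uIoc_subset_uIcc))
  have hright : ∫ u in (0 : ℝ)..(2 * π), ∫ t in (0 : ℝ)..(2 * π),
      polIntegrand H t * polIntegrand H (t + u) = (2 * π) • (-(2 * π)) • (1 : B) := by
    rw [intervalIntegral.integral_congr_ae (hcorr.mono fun u hu _ ↦ hu),
      intervalIntegral.integral_const, sub_zero]
  have hleft : ∫ t in (0 : ℝ)..(2 * π), ∫ u in (0 : ℝ)..(2 * π),
      polIntegrand H t * polIntegrand H (t + u) = ((2 * π) • pol H) * ((2 * π) • pol H) := by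
    calc
      _ = ∫ t in (0 : ℝ)..(2 * π), ((2 * π) • pol H) * polIntegrand H t := by
        refine intervalIntegral.integral_congr fun t _ ↦ ?_
        rw [hmul _ (by fun_prop), mul_comm]
        simp_rw [add_comm t]
        rw [hshift]
      _ = _ := by rw [hmul _ hcont, intervalIntegral_polIntegrand]
  rw [hleft, hright, smul_mul_smul_comm, smul_smul, mul_neg, neg_smul, ← smul_neg] at hswap
  have hpi : (2 * π * (2 * π)) ≠ 0 := by positivity
  rw [sq]
  exact smul_right_injective B hpi hswap

theorem exists_character_of_not_isUnit [CompleteSpace B] {a : B} (ha : ¬IsUnit a) :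
    ∃ φ : B →ₐ[ℂ] ℂ, Continuous φ ∧ φ a = 0 := by
  obtain ⟨φ, hφ⟩ := WeakDual.CharacterSpace.exists_apply_eq_zero ha
  exact ⟨WeakDual.CharacterSpace.equivAlgHom φ, map_continuous φ, hφ⟩

theorem Complex.re_eq_zero_of_sq_eq_neg_one {q : ℂ} (hq : q ^ 2 = -1) : q.re = 0 := by
  have : (q - I) * (q + I) = 0 := by linear_combination hq - Complex.I_sq
  rcases mul_eq_zero.mp this with h | h
  · simp [sub_eq_zero.mp h]
  · simp [eq_neg_of_add_eq_zero_left h]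

theorem Complex.im_polIntegrand {z : ℂ} (t : ℝ) :
    (polIntegrand z t).im = z.im / Complex.normSq (Real.cos t • (1 : ℂ) + Real.sin t • z) := by
  rw [polIntegrand, Ring.inverse_eq_inv', Complex.mul_im, Complex.inv_re, Complex.inv_im]
  simp only [Complex.add_re, Complex.add_im, Complex.real_smul, Complex.mul_re, Complex.mul_im,
    Complex.ofReal_re, Complex.ofReal_im, Complex.one_re, Complex.one_im]
  linear_combination z.im / Complex.normSq (Real.cos t • (1 : ℂ) + Real.sin t • z) *
    Real.sin_sq_add_cos_sq t

theorem Complex.im_mul_im_pol_pos {z : ℂ} (hz : z.im ≠ 0) : 0 < z.im * (pol z).im := by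
  have hspec : ∀ w ∈ spectrum ℂ z, w.im ≠ 0 := by
    have : spectrum ℂ z = {z} := spectrum.scalar_eq (A := ℂ) z
    simpa [this] using hz
  have hcont := continuous_polIntegrand hspec
  have him : (pol z).im = (2 * π)⁻¹ * ∫ t in (0 : ℝ)..(2 * π), (polIntegrand z t).im := by
    have h := Complex.imCLM.intervalIntegral_comp_comm
      (hcont.intervalIntegrable (μ := volume) 0 (2 * π))
    simp only [Complex.imCLM_apply] at h
    rw [h, pol_eq, Complex.smul_im, smul_eq_mul]
  have hint : 0 < ∫ t in (0 : ℝ)..(2 * π), z.im * (polIntegrand z t).im := by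
    refine intervalIntegral.intervalIntegral_pos_of_pos
      (Continuous.intervalIntegrable (by fun_prop) _ _) (fun t ↦ ?_) (by positivity)
    have := Complex.normSq_pos.mpr (isUnit_cos_add_sin_smul hspec t).ne_zero
    rw [Complex.im_polIntegrand, ← mul_div_assoc]
    have := mul_self_pos.mpr hz
    positivity
  rw [intervalIntegral.integral_const_mul] at hint
  rw [him, mul_left_comm]
  positivity

/-- Characterization of the polarization in a commutative Banach algebra, by means of characters. -/
theorem eq_pol_iff_of_comm [CompleteSpace B] (H : B) (hH : ∀ z ∈ spectrum ℂ H, z.im ≠ 0)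
    (Q : B) :
    Q = pol H ↔ Q ^ 2 = -1 ∧ ∀ z ∈ spectrum ℂ (H * (-Q)), 0 < z.re := by
  have hpos (φ : B →ₐ[ℂ] ℂ) (hφ : Continuous φ) : 0 < (φ H).im * (φ (pol H)).im := by
    rw [φ.map_pol hφ hH]
    exact Complex.im_mul_im_pol_pos (hH _ (AlgHom.apply_mem_spectrum φ H))
  have hre {Q : B} (hQ : Q ^ 2 = -1) (φ : B →ₐ[ℂ] ℂ) :
      (φ (H * (-Q))).re = (φ H).im * (φ Q).im := by
    have : (φ Q).re = 0 :=
      Complex.re_eq_zero_of_sq_eq_neg_one (by rw [← map_pow, hQ, map_neg, map_one])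
    simp [this]
  constructor
  · rintro rfl
    refine ⟨pol_sq hH, fun z hz ↦ ?_⟩
    obtain ⟨φ, hφ, hz⟩ := exists_character_of_not_isUnit hz
    rw [map_sub, AlgHom.commutes, sub_eq_zero] at hz
    change z = _ at hz
    rw [hz, hre (pol_sq hH)]
    exact hpos φ hφ
  · rintro ⟨hQ, hspec⟩
    have hunit : IsUnit (Q + pol H) := by
      by_contra h
      obtain ⟨φ, hφ, hz⟩ := exists_character_of_not_isUnit h
      have h₁ := hspec _ (AlgHom.apply_mem_spectrum φ _)
      rw [hre hQ] at h₁
      have h₂ := hpos φ hφ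
      rw [map_add] at hz
      have h₃ := congrArg Complex.im hz
      rw [Complex.add_im, Complex.zero_im] at h₃
      linarith [congrArg ((φ H).im * ·) h₃, mul_add (φ H).im (φ Q).im (φ (pol H)).im,
        mul_zero (φ H).im]
    refine hunit.mul_left_cancel ?_
    linear_combination hQ - pol_sq hH

end Commutative

theorem Subalgebra.isUnit_coe_centralizer_iff {R A : Type*} [CommRing R] [Ring A] [Algebra R A]
    {s : Set A} {x : Subalgebra.centralizer R s} : IsUnit (x : A) ↔ IsUnit x := by
  refine ⟨fun h ↦ ?_, fun h ↦ h.map (Subalgebra.centralizer R s).val⟩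
  obtain ⟨u, hu⟩ := h
  have hmem : ((u⁻¹ : Aˣ) : A) ∈ Subalgebra.centralizer R s := fun g hg ↦ by
    have : Commute g u := by
      rw [hu]
      exact x.2 g hg
    exact this.units_inv_right
  exact ⟨⟨x, ⟨_, hmem⟩, Subtype.ext (by simp [← hu]), Subtype.ext (by simp [← hu])⟩, rfl⟩

/-- Centralizers are inverse-closed, so the spectrum does not depend on the ambient algebra. -/
theorem Subalgebra.spectrum_coe_centralizer {R A : Type*} [CommRing R] [Ring A] [Algebra R A]
    {s : Set A} (x : Subalgebra.centralizer R s) : spectrum R (x : A) = spectrum R x := by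
  ext r
  rw [spectrum.mem_iff, spectrum.mem_iff, ← Subalgebra.isUnit_coe_centralizer_iff]
  rfl

theorem stmt5 {𝔄 : Type*} [NormedRing 𝔄] [NormedAlgebra ℂ 𝔄] [CompleteSpace 𝔄]
    (H : 𝔄) (hH : ∀ z ∈ spectrum ℂ H, z.im ≠ 0) (Q : 𝔄) :
    Q = pol H ↔
      (Q ^ 2 = -1 ∧ H * Q = Q * H ∧ ∀ z ∈ spectrum ℂ (H * (-Q)), 0 < z.re) := by
  suffices key : H * Q = Q * H →
      (Q = pol H ↔ Q ^ 2 = -1 ∧ ∀ z ∈ spectrum ℂ (H * (-Q)), 0 < z.re) by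
    constructor
    · intro h
      have hcomm : H * Q = Q * H := h ▸ commute_pol hH (Commute.refl H)
      have := (key hcomm).mp h
      exact ⟨this.1, hcomm, this.2⟩
    · rintro ⟨hsq, hcomm, hspec⟩
      exact (key hcomm).mpr ⟨hsq, hspec⟩
  intro hcomm
  let S := Subalgebra.centralizer ℂ (Set.centralizer {H, Q})
  have hpair : ∀ x ∈ ({H, Q} : Set 𝔄), ∀ y ∈ ({H, Q} : Set 𝔄), x * y = y * x := by
    rintro x (rfl | rfl) y (rfl | rfl) <;> simp [hcomm]
  have hclosed : IsClosed (S : Set 𝔄) := Set.isClosed_centralizer _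
  have : CompleteSpace S := hclosed.completeSpace_coe
  let _ : NormedCommRing S :=
    { (inferInstance : NormedRing S) with
      mul_comm := fun x y ↦ Subtype.ext <|
        Set.centralizer_centralizer_comm_of_comm hpair x x.2 y y.2 }
  let H' : S := ⟨H, Set.subset_centralizer_centralizer (by simp)⟩
  let Q' : S := ⟨Q, Set.subset_centralizer_centralizer (by simp)⟩
  have hH' : ∀ z ∈ spectrum ℂ H', z.im ≠ 0 := by
    rwa [← Subalgebra.spectrum_coe_centralizer]
  have hpol : ((pol H' : S) : 𝔄) = pol H := AlgHom.map_pol S.val continuous_subtype_val hH'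
  have hmain := eq_pol_iff_of_comm H' hH' Q'
  rw [← Subalgebra.spectrum_coe_centralizer, Subtype.ext_iff, Subtype.ext_iff, hpol] at hmain
  exact hmain
end

section
/- Let 𝔄 be a unital complex Banach algebra, let H ∈ 𝔄 have spectrum disjoint from ℝ, and let a, b, c, d ∈ ℝ with ad − bc ≠ 0. Then c·H + d·1 is invertible, the element (a·H + b·1)·(c·H + d·1)⁻¹ has spectrum disjoint from ℝ, and pol((a·H + b·1)·(c·H + d·1)⁻¹) = sgn(ad − bc) · pol H. -/
theorem exists_log_ellipse_of_pos {z₀ z₁ : ℂ} (hz₀ : z₀ ≠ 0) (h : 0 < (z₁ / z₀).im) :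
    ∃ L : ℝ → ℂ, Differentiable ℝ L ∧
      (∀ t : ℝ, Complex.exp (L t) = Real.cos t * z₀ + Real.sin t * z₁) ∧
      ∀ t : ℝ, L (t + 2 * Real.pi) = L t + ((2 * Real.pi : ℝ) : ℂ) * Complex.I := by
  set ζ := z₁ / z₀ with hζ
  let w : ℝ → ℂ := fun t => (Real.cos t + Real.sin t * ζ) * (Real.cos t - Real.sin t * Complex.I)
  have hw : ∀ t, w t ∈ Complex.slitPlane := by
    intro t
    rw [Complex.mem_slitPlane_iff]
    by_contra! hc
    obtain ⟨hre, him⟩ := hc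
    simp only [w, Complex.mul_re, Complex.mul_im, Complex.add_re, Complex.add_im, Complex.sub_re,
      Complex.sub_im, Complex.ofReal_re, Complex.ofReal_im, Complex.I_re, Complex.I_im] at hre him
    have hsc := Real.sin_sq_add_cos_sq t
    by_cases hs : Real.sin t = 0
    · rw [hs] at hre hsc
      nlinarith
    · have h1 : ζ.im * Real.cos t = Real.cos t + Real.sin t * ζ.re := by
        apply mul_left_cancel₀ hs
        linear_combination him
      have h2 : ζ.im = Real.cos t * (Real.cos t + Real.sin t * ζ.re)
          + Real.sin t * Real.sin t * ζ.im := by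
        rw [← h1]
        linear_combination -ζ.im * hsc
      nlinarith
  have hwd : Differentiable ℝ w := by
    have hc : Differentiable ℝ fun t : ℝ => (Real.cos t : ℂ) := fun t =>
      (Real.hasDerivAt_cos t).ofReal_comp.differentiableAt
    have hs : Differentiable ℝ fun t : ℝ => (Real.sin t : ℂ) := fun t =>
      (Real.hasDerivAt_sin t).ofReal_comp.differentiableAt
    exact (hc.add (hs.mul_const _)).mul (hc.sub (hs.mul_const _))
  refine ⟨fun t => Complex.log z₀ + (t : ℂ) * Complex.I + Complex.log (w t), ?_, ?_, ?_⟩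
  · intro t
    have h1 : DifferentiableAt ℝ (fun t : ℝ => (t : ℂ)) t :=
      (hasDerivAt_id t).ofReal_comp.differentiableAt
    exact ((h1.mul_const _).const_add _).add ((hwd t).hasDerivAt.clog_real (hw t)).differentiableAt
  · intro t
    rw [Complex.exp_add, Complex.exp_add, Complex.exp_log hz₀,
      Complex.exp_log (Complex.slitPlane_ne_zero (hw t)), Complex.exp_mul_I]
    have hz₁ : z₁ = z₀ * ζ := by rw [hζ]; field_simp
    have hsc := Complex.sin_sq_add_cos_sq (t : ℂ)
    simp only [w, Complex.ofReal_cos, Complex.ofReal_sin]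
    rw [hz₁]
    linear_combination z₀ * (Complex.cos t + Complex.sin t * ζ) * hsc -
      z₀ * (Complex.cos t + Complex.sin t * ζ) * Complex.sin t ^ 2 * Complex.I_sq
  · intro t
    simp only [w, Real.cos_add_two_pi, Real.sin_add_two_pi]
    push_cast
    ring

theorem exists_log_ellipse {z₀ z₁ : ℂ} (hz₀ : z₀ ≠ 0) (h : (z₁ / z₀).im ≠ 0) :
    ∃ L : ℝ → ℂ, Differentiable ℝ L ∧
      (∀ t : ℝ, Complex.exp (L t) = Real.cos t * z₀ + Real.sin t * z₁) ∧
      L (2 * Real.pi) =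
        L 0 + ((Real.sign (z₁ / z₀).im * (2 * Real.pi) : ℝ) : ℂ) * Complex.I := by
  rcases h.lt_or_gt with hneg | hpos
  · obtain ⟨L, hd, he, hp⟩ := exists_log_ellipse_of_pos (z₁ := -z₁) hz₀
      (by rw [neg_div, Complex.neg_im]; linarith)
    refine ⟨fun t => L (-t), hd.comp differentiable_neg, fun t => ?_, ?_⟩
    · rw [he]; simp
    · have := hp (-(2 * Real.pi))
      rw [neg_add_cancel] at this
      simp only [Real.sign_of_neg hneg, neg_zero, this]
      push_cast
      ring
  · obtain ⟨L, hd, he, hp⟩ := exists_log_ellipse_of_pos hz₀ hpos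
    refine ⟨L, hd, he, ?_⟩
    rw [Real.sign_of_pos hpos, one_mul, ← hp 0, zero_add]

theorem Continuous.mul_ringInverse {𝔄 : Type*} [NormedRing 𝔄] [CompleteSpace 𝔄]
    {p q : ℝ → 𝔄} (hp : Continuous p) (hq : Continuous q) (hu : ∀ t, IsUnit (q t)) :
    Continuous fun t => p t * Ring.inverse (q t) := by
  refine hp.mul (continuous_iff_continuousAt.mpr fun t => ?_)
  obtain ⟨u, hu⟩ := hu t
  have h := NormedRing.inverse_continuousAt u
  rw [hu] at h
  exact ContinuousAt.comp (g := Ring.inverse) h hq.continuousAt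

section Polarization

variable {𝔄 : Type*} [NormedRing 𝔄] [NormedAlgebra ℂ 𝔄]

theorem isUnit_smul_one_add_smul_s6 {H : 𝔄} (hH : ∀ z ∈ spectrum ℂ H, z.im ≠ 0) {x y : ℝ}
    (hxy : x ≠ 0 ∨ y ≠ 0) : IsUnit (x • (1 : 𝔄) + y • H) := by
  by_cases hy : y = 0
  · have hx : x ≠ 0 := by tauto
    rw [hy, zero_smul, add_zero]
    exact (isUnit_one (M := 𝔄)).smul (Units.mk0 x hx)
  · have h1 : ((-(x / y) : ℝ) : ℂ) ∉ spectrum ℂ H := fun h => hH _ h (Complex.ofReal_im _)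
    rw [spectrum.notMem_iff] at h1
    have h2 := h1.smul (Units.mk0 (-y) (neg_ne_zero.mpr hy))
    convert h2 using 1
    rw [Units.smul_def, Units.val_mk0, smul_sub, Algebra.algebraMap_eq_smul_one,
      Complex.coe_smul, smul_smul, neg_smul, sub_neg_eq_add]
    congr 2
    field_simp

theorem integral_logDeriv_ellipse [CompleteSpace 𝔄] {H : 𝔄}
    (hH : ∀ z ∈ spectrum ℂ H, z.im ≠ 0) {a b c d : ℝ} (habcd : a * d - b * c ≠ 0) :
    ∫ t in (0 : ℝ)..(2 * Real.pi),
      ((-Real.sin t) • (c • H + d • (1 : 𝔄)) + Real.cos t • (a • H + b • (1 : 𝔄))) *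
        Ring.inverse (Real.cos t • (c • H + d • (1 : 𝔄)) + Real.sin t • (a • H + b • (1 : 𝔄))) =
    Real.sign (a * d - b * c) • ∫ t in (0 : ℝ)..(2 * Real.pi),
      ((-Real.sin t) • (1 : 𝔄) + Real.cos t • H) *
        Ring.inverse (Real.cos t • (1 : 𝔄) + Real.sin t • H) := by
  set F : ℝ → 𝔄 := fun t => ((-Real.sin t) • (1 : 𝔄) + Real.cos t • H) *
    Ring.inverse (Real.cos t • (1 : 𝔄) + Real.sin t • H) with hF
  have hunit : ∀ t, IsUnit (Real.cos t • (1 : 𝔄) + Real.sin t • H) := fun t =>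
    isUnit_smul_one_add_smul_s6 hH (by
      by_contra! hc
      have := Real.sin_sq_add_cos_sq t
      simp [hc.1, hc.2] at this)
  have hFc : Continuous F :=
    Continuous.mul_ringInverse (by fun_prop) (by fun_prop) hunit
  have hFp : Function.Periodic F (2 * Real.pi) := fun t => by
    simp only [hF, Real.sin_add_two_pi, Real.cos_add_two_pi]
  set z₀ : ℂ := ⟨d, c⟩ with hz₀
  set z₁ : ℂ := ⟨b, a⟩ with hz₁
  have hz₀0 : z₀ ≠ 0 := by
    intro h
    have h1 := congrArg Complex.re h
    have h2 := congrArg Complex.im h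
    simp only [hz₀, Complex.zero_re, Complex.zero_im] at h1 h2
    exact habcd (by rw [h1, h2]; ring)
  have him : (z₁ / z₀).im = (a * d - b * c) / Complex.normSq z₀ := by
    rw [Complex.div_im]
    simp only [hz₀, hz₁]
    ring
  have hN : 0 < Complex.normSq z₀ := Complex.normSq_pos.mpr hz₀0
  have hsign : Real.sign (z₁ / z₀).im = Real.sign (a * d - b * c) := by
    rw [him]
    rcases habcd.lt_or_gt with h | h
    · rw [Real.sign_of_neg h, Real.sign_of_neg (div_neg_of_neg_of_pos h hN)]
    · rw [Real.sign_of_pos h, Real.sign_of_pos (div_pos h hN)]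
  obtain ⟨L, hLd, hLe, hLp⟩ := exists_log_ellipse hz₀0
    (by rw [him]; exact div_ne_zero habcd hN.ne')
  rw [hsign] at hLp
  have hL' : ∀ t, deriv L t * Complex.exp (L t) = -Real.sin t * z₀ + Real.cos t * z₁ := by
    intro t
    have h1 : HasDerivAt (fun t => Complex.exp (L t)) (Complex.exp (L t) * deriv L t) t :=
      (hLd t).hasDerivAt.cexp
    have h2 : HasDerivAt (fun t : ℝ => (Real.cos t : ℂ) * z₀ + Real.sin t * z₁)
        (((-Real.sin t : ℝ) : ℂ) * z₀ + Real.cos t * z₁) t :=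
      ((Real.hasDerivAt_cos t).ofReal_comp.mul_const z₀).add
        ((Real.hasDerivAt_sin t).ofReal_comp.mul_const z₁)
    rw [funext hLe] at h1
    rw [mul_comm, h1.unique h2, Complex.ofReal_neg]
  have hQ : ∀ t, Real.cos t • (c • H + d • (1 : 𝔄)) + Real.sin t • (a • H + b • (1 : 𝔄)) =
      Real.exp (L t).re •
        (Real.cos (L t).im • (1 : 𝔄) + Real.sin (L t).im • H) := by
    intro t
    have h1 := congrArg Complex.re (hLe t)
    have h2 := congrArg Complex.im (hLe t)
    simp only [hz₀, hz₁, Complex.exp_re, Complex.exp_im, Complex.add_re, Complex.add_im,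
      Complex.re_ofReal_mul, Complex.im_ofReal_mul] at h1 h2
    rw [smul_add (Real.exp _), smul_smul, smul_smul, h1, h2]
    module
  have hP : ∀ t, (-Real.sin t) • (c • H + d • (1 : 𝔄)) + Real.cos t • (a • H + b • (1 : 𝔄)) =
      Real.exp (L t).re •
        ((deriv L t).re • (Real.cos (L t).im • (1 : 𝔄) + Real.sin (L t).im • H) +
          (deriv L t).im • ((-Real.sin (L t).im) • (1 : 𝔄) + Real.cos (L t).im • H)) := by
    intro t
    have h1 := congrArg Complex.re (hL' t)
    have h2 := congrArg Complex.im (hL' t)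
    rw [← Complex.ofReal_neg] at h1 h2
    simp only [hz₀, hz₁, Complex.exp_re, Complex.exp_im, Complex.add_re, Complex.add_im,
      Complex.mul_re (deriv L t), Complex.mul_im (deriv L t),
      Complex.re_ofReal_mul, Complex.im_ofReal_mul] at h1 h2
    trans (-Real.sin t * d + Real.cos t * b) • (1 : 𝔄) + (-Real.sin t * c + Real.cos t * a) • H
    · module
    · rw [← h1, ← h2]
      module
  have hunitQ : ∀ t, IsUnit (Real.cos t • (c • H + d • (1 : 𝔄)) +
      Real.sin t • (a • H + b • (1 : 𝔄))) := by
    intro t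
    rw [hQ]
    exact (hunit _).smul (Units.mk0 _ (Real.exp_ne_zero (L t).re))
  have hderiv : ∀ t, HasDerivAt
      (fun t => (L t).re • (1 : 𝔄) + ∫ s in (0 : ℝ)..(L t).im, F s)
      (((-Real.sin t) • (c • H + d • (1 : 𝔄)) + Real.cos t • (a • H + b • (1 : 𝔄))) *
        Ring.inverse (Real.cos t • (c • H + d • (1 : 𝔄)) +
          Real.sin t • (a • H + b • (1 : 𝔄)))) t := by
    intro t
    have hre : HasDerivAt (fun t => (L t).re) (deriv L t).re t :=
      Complex.reCLM.hasFDerivAt.comp_hasDerivAt t (hLd t).hasDerivAt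
    have him : HasDerivAt (fun t => (L t).im) (deriv L t).im t :=
      Complex.imCLM.hasFDerivAt.comp_hasDerivAt t (hLd t).hasDerivAt
    have hG : HasDerivAt (fun x => ∫ s in (0 : ℝ)..x, F s) (F (L t).im) (L t).im :=
      hFc.integral_hasStrictDerivAt 0 _ |>.hasDerivAt
    have h := (hre.smul_const (1 : 𝔄)).add (hG.scomp t him)
    refine h.congr_deriv (Eq.symm ?_)
    rw [← (hunitQ t).mul_left_inj, mul_assoc, Ring.inverse_mul_cancel _ (hunitQ t), mul_one, hP,
      hQ, mul_smul_comm, add_mul, smul_mul_assoc, smul_mul_assoc, one_mul, hF]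
    simp only [mul_assoc, Ring.inverse_mul_cancel _ (hunit _), mul_one]
  rw [intervalIntegral.integral_eq_sub_of_hasDerivAt (fun t _ => hderiv t)
    ((Continuous.mul_ringInverse (by fun_prop) (by fun_prop)
      hunitQ).intervalIntegrable _ _)]
  have hi : ∀ x y, IntervalIntegrable F MeasureTheory.volume x y := fun x y =>
    hFc.intervalIntegrable x y
  have hLre : (L (2 * Real.pi)).re = (L 0).re := by
    rw [hLp, Complex.add_re, Complex.re_ofReal_mul, Complex.I_re, mul_zero, add_zero]
  have hLim : (L (2 * Real.pi)).im = (L 0).im + Real.sign (a * d - b * c) * (2 * Real.pi) := by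
    rw [hLp, Complex.add_im, Complex.im_ofReal_mul, Complex.I_im, mul_one]
  rw [hLre, hLim, add_sub_add_left_eq_sub,
    intervalIntegral.integral_interval_sub_left (hi _ _) (hi _ _)]
  rcases habcd.lt_or_gt with h | h
  · rw [Real.sign_of_neg h, intervalIntegral.integral_symm, neg_one_smul, neg_inj]
    have := hFp.intervalIntegral_add_eq ((L 0).im + -1 * (2 * Real.pi)) 0
    rwa [neg_one_mul, neg_add_cancel_right, zero_add, ← neg_one_mul] at this
  · rw [Real.sign_of_pos h, one_smul, one_mul, hFp.intervalIntegral_add_eq (L 0).im 0, zero_add]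

end Polarization

theorem stmt6 {𝔄 : Type*} [NormedRing 𝔄] [NormedAlgebra ℂ 𝔄] [CompleteSpace 𝔄]
    (H : 𝔄) (hH : ∀ z ∈ spectrum ℂ H, z.im ≠ 0)
    (a b c d : ℝ) (habcd : a * d - b * c ≠ 0) :
    IsUnit (c • H + d • (1 : 𝔄)) ∧
    (∀ z ∈ spectrum ℂ ((a • H + b • (1 : 𝔄)) * Ring.inverse (c • H + d • (1 : 𝔄))), z.im ≠ 0) ∧
    pol ((a • H + b • (1 : 𝔄)) * Ring.inverse (c • H + d • (1 : 𝔄)))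
      = Real.sign (a * d - b * c) • pol H := by
  have hcomb : ∀ x y : ℝ, x ≠ 0 ∨ y ≠ 0 →
      IsUnit (x • (c • H + d • (1 : 𝔄)) + y • (a • H + b • (1 : 𝔄))) := by
    intro x y hxy
    have h := isUnit_smul_one_add_smul_s6 hH (x := x * d + y * b) (y := x * c + y * a) (by
      by_contra! hc
      obtain ⟨h1, h2⟩ := hc
      have hx : x * (a * d - b * c) = 0 := by linear_combination a * h1 - b * h2
      have hy : y * (a * d - b * c) = 0 := by linear_combination d * h2 - c * h1
      simp only [mul_eq_zero, habcd, or_false] at hx hy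
      tauto)
    convert h using 1
    module
  have hU : IsUnit (c • H + d • (1 : 𝔄)) := by
    simpa using hcomb 1 0 (Or.inl one_ne_zero)
  have hinv : ∀ x y : ℝ,
      x • (1 : 𝔄) + y • ((a • H + b • (1 : 𝔄)) * Ring.inverse (c • H + d • (1 : 𝔄))) =
      (x • (c • H + d • (1 : 𝔄)) + y • (a • H + b • (1 : 𝔄))) *
        Ring.inverse (c • H + d • (1 : 𝔄)) := by
    intro x y
    rw [add_mul (x • _), smul_mul_assoc, smul_mul_assoc, Ring.mul_inverse_cancel _ hU]
  refine ⟨hU, fun z hz him => ?_, ?_⟩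
  · refine hz ?_
    have hzr : z = (z.re : ℂ) := Complex.ext rfl (by simp [him])
    rw [hzr, spectrum.mem_resolventSet_iff, Algebra.algebraMap_eq_smul_one, Complex.coe_smul, sub_eq_add_neg,
      ← neg_one_smul ℝ ((a • H + b • (1 : 𝔄)) * _), hinv]
    exact (hcomb _ _ (Or.inr (by norm_num))).mul hU.ringInverse
  · rw [pol, pol, smul_comm, ← integral_logDeriv_ellipse hH habcd]
    congr 1
    refine intervalIntegral.integral_congr fun t _ => ?_
    have hunit := hcomb (Real.cos t) (Real.sin t) (by
      by_contra! hc
      have := Real.sin_sq_add_cos_sq t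
      simp [hc.1, hc.2] at this)
    have hunit' := hunit.mul hU.ringInverse
    simp only [hinv]
    rw [← hunit'.mul_left_inj, mul_assoc, Ring.inverse_mul_cancel _ hunit', mul_one, mul_assoc,
      Ring.inverse_mul_cancel_left _ _ hunit]
end

section
/- Let 𝔄 be a unital associative algebra over ℝ and let (Q₁, …, Qₙ) be a Clifford system in 𝔄. Then the map X ↦ ([X, Q₁], …, [X, Qₙ]) (where [X, Q] = XQ − QX) is a bijection from the set T_Q := {X ∈ 𝔄 : the iterated full symmetrization X⁰_{Q₁}⁰_{Q₂}⋯⁰_{Qₙ} equals 0} onto the set 𝐓_Q := {(R₁, …, Rₙ) ∈ 𝔄ⁿ : RᵢQⱼ + RⱼQᵢ + QᵢRⱼ + QⱼRᵢ = 0 for all i, j}. -/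
/-- `symA Q ι R` is the symmetrization `R⁰_Q = ½(R + Q⁻¹RQ)` (for `ι = false`, i.e. `ι = 0`)
resp. the antisymmetrization `R¹_Q = ½(R − Q⁻¹RQ)` (for `ι = true`, i.e. `ι = 1`)
of `R` with respect to `Q`. -/
noncomputable def symA {𝔄 : Type*} [Ring 𝔄] [Module ℝ 𝔄] (Q : 𝔄) (ι : Bool) (R : 𝔄) : 𝔄 :=
  if ι then (2⁻¹ : ℝ) • (R - Ring.inverse Q * R * Q)
  else (2⁻¹ : ℝ) • (R + Ring.inverse Q * R * Q)

/-- `iterSym Q ι R = R^{ι₁}_{Q₁}{}^{ι₂}_{Q₂}⋯^{ιₙ}_{Qₙ}`, the iterated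
(anti)symmetrization obtained by applying `R ↦ R^{ι_i}_{Q_i}` successively for
`i = 1, …, n`. -/
noncomputable def iterSym {𝔄 : Type*} [Ring 𝔄] [Module ℝ 𝔄] :
    {n : ℕ} → (Fin n → 𝔄) → (Fin n → Bool) → 𝔄 → 𝔄
  | 0, _, _, R => R
  | _ + 1, Q, ι, R => iterSym (fun i => Q i.succ) (fun i => ι i.succ) (symA (Q 0) (ι 0) R)

/-- A Clifford system: `QᵢQⱼ + QⱼQᵢ = −2δᵢⱼ·1`. -/
def IsCliffordSystem {𝔄 : Type*} [Ring 𝔄] {n : ℕ} (Q : Fin n → 𝔄) : Prop :=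
  ∀ i j, Q i * Q j + Q j * Q i = if i = j then (-2 : 𝔄) else 0

section Ring

variable {𝔄 : Type*} [Ring 𝔄]

theorem IsCliffordSystem.mul_eq_neg_mul {n : ℕ} {Q : Fin n → 𝔄} (hQ : IsCliffordSystem Q)
    {i j : Fin n} (hij : i ≠ j) : Q i * Q j = -(Q j * Q i) := by
  have h := hQ i j
  rw [if_neg hij] at h
  exact eq_neg_of_add_eq_zero_left h

theorem IsCliffordSystem.tail {n : ℕ} {Q : Fin (n + 1) → 𝔄} (hQ : IsCliffordSystem Q) :
    IsCliffordSystem fun i => Q (Fin.succ i) := by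
  intro i j
  simpa using hQ i.succ j.succ

theorem Ring.inverse_eq_neg_of_mul_self {Q : 𝔄} (h : Q * Q = -1) : Ring.inverse Q = -Q :=
  Ring.inverse_unit (⟨Q, -Q, by simp [h], by simp [h]⟩ : 𝔄ˣ)

theorem IsCliffordSystem.commutator_relation {n : ℕ} {Q : Fin n → 𝔄} (hQ : IsCliffordSystem Q)
    (X : 𝔄) (i j : Fin n) :
    (X * Q i - Q i * X) * Q j + (X * Q j - Q j * X) * Q i
      + Q i * (X * Q j - Q j * X) + Q j * (X * Q i - Q i * X) = 0 := by
  have h : (X * Q i - Q i * X) * Q j + (X * Q j - Q j * X) * Q i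
      + Q i * (X * Q j - Q j * X) + Q j * (X * Q i - Q i * X)
      = X * (Q i * Q j + Q j * Q i) - (Q i * Q j + Q j * Q i) * X := by noncomm_ring
  rw [h, hQ i j]
  split_ifs <;> noncomm_ring

end Ring

section Algebra

variable {𝔄 : Type*} [Ring 𝔄] [Algebra ℝ 𝔄]

theorem IsCliffordSystem.mul_self {n : ℕ} {Q : Fin n → 𝔄} (hQ : IsCliffordSystem Q) (i : Fin n) :
    Q i * Q i = -1 := by
  have h := hQ i i
  rw [if_pos rfl, ← two_smul ℝ] at h
  have h2 : (-2 : 𝔄) = (2 : ℝ) • (-1 : 𝔄) := by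
    rw [two_smul]; norm_num
  rw [h2] at h
  exact smul_right_injective 𝔄 (two_ne_zero : (2 : ℝ) ≠ 0) h

theorem symA_false_eq {Q : 𝔄} (h : Q * Q = -1) (X : 𝔄) :
    symA Q false X = (2⁻¹ : ℝ) • (X - Q * X * Q) := by
  simp [symA, Ring.inverse_eq_neg_of_mul_self h, sub_eq_add_neg]

theorem symA_false_sub (Q X Y : 𝔄) :
    symA Q false (X - Y) = symA Q false X - symA Q false Y := by
  simp only [symA, Bool.false_eq_true, if_false, ← smul_sub]
  congr 1
  noncomm_ring

theorem symA_false_of_commute {Q X : 𝔄} (h : Q * Q = -1) (hX : X * Q = Q * X) :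
    symA Q false X = X := by
  have h1 : X - Q * X * Q = (2 : ℝ) • X := by
    rw [← hX, mul_assoc, h, two_smul]; simp
  rw [symA_false_eq h, h1, smul_smul]
  norm_num

theorem symA_false_mul_self_comm {Q : 𝔄} (h : Q * Q = -1) (X : 𝔄) :
    symA Q false X * Q = Q * symA Q false X := by
  rw [symA_false_eq h, smul_mul_assoc, mul_smul_comm]
  congr 1
  have h1 : (X - Q * X * Q) * Q = X * Q - Q * X * (Q * Q) := by noncomm_ring
  have h2 : Q * (X - Q * X * Q) = Q * X - (Q * Q) * X * Q := by noncomm_ring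
  rw [h1, h2, h]
  noncomm_ring

theorem symA_false_comm_of_anticomm {Q A X : 𝔄} (h : Q * Q = -1) (hA : A * Q = -(Q * A))
    (hX : X * A = A * X) : symA Q false X * A = A * symA Q false X := by
  rw [symA_false_eq h, smul_mul_assoc, mul_smul_comm]
  congr 1
  have hA' : Q * A = -(A * Q) := by rw [hA, neg_neg]
  have key : Q * X * Q * A = A * (Q * X * Q) := by
    calc Q * X * Q * A = -(Q * (X * A) * Q) := by rw [mul_assoc (Q * X), hA']; noncomm_ring
      _ = -(Q * A * X * Q) := by rw [hX]; noncomm_ring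
      _ = A * (Q * X * Q) := by rw [hA']; noncomm_ring
  rw [sub_mul, mul_sub, key, hX]

theorem iterSym_false_sub {n : ℕ} (Q : Fin n → 𝔄) (X Y : 𝔄) :
    iterSym Q (fun _ => false) (X - Y) =
      iterSym Q (fun _ => false) X - iterSym Q (fun _ => false) Y := by
  induction n generalizing X Y with
  | zero => rfl
  | succ n ih => simp only [iterSym, symA_false_sub, ih]

theorem iterSym_false_of_commute {n : ℕ} {Q : Fin n → 𝔄} (hQ : IsCliffordSystem Q) {X : 𝔄}
    (hX : ∀ i, X * Q i = Q i * X) : iterSym Q (fun _ => false) X = X := by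
  induction n with
  | zero => rfl
  | succ n ih =>
    simp only [iterSym]
    rw [symA_false_of_commute (hQ.mul_self 0) (hX 0)]
    exact ih hQ.tail fun i => hX i.succ

theorem iterSym_false_comm_of_anticomm {n : ℕ} {Q : Fin n → 𝔄} (hQ : IsCliffordSystem Q)
    {A X : 𝔄} (hA : ∀ i, A * Q i = -(Q i * A)) (hX : X * A = A * X) :
    iterSym Q (fun _ => false) X * A = A * iterSym Q (fun _ => false) X := by
  induction n generalizing X with
  | zero => exact hX
  | succ n ih =>
    exact ih hQ.tail (fun i => hA i.succ)
      (symA_false_comm_of_anticomm (hQ.mul_self 0) (hA 0) hX)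

theorem iterSym_false_comm {n : ℕ} {Q : Fin n → 𝔄} (hQ : IsCliffordSystem Q) (X : 𝔄)
    (i : Fin n) :
    iterSym Q (fun _ => false) X * Q i = Q i * iterSym Q (fun _ => false) X := by
  induction n generalizing X with
  | zero => exact i.elim0
  | succ n ih =>
    cases i using Fin.cases with
    | zero =>
      exact iterSym_false_comm_of_anticomm hQ.tail
        (fun j => hQ.mul_eq_neg_mul (Fin.succ_ne_zero j).symm)
        (symA_false_mul_self_comm (hQ.mul_self 0) X)
    | succ i => exact ih hQ.tail _ i

theorem IsCliffordSystem.exists_commutator_eq {n : ℕ} {Q : Fin n → 𝔄}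
    (hQ : IsCliffordSystem Q) {R : Fin n → 𝔄}
    (hR : ∀ i j, R i * Q j + R j * Q i + Q i * R j + Q j * R i = 0) :
    ∃ X : 𝔄, ∀ i, X * Q i - Q i * X = R i := by
  induction n with
  | zero => exact ⟨0, fun i => i.elim0⟩
  | succ n ih =>
    obtain ⟨Y, hY⟩ := ih hQ.tail (R := fun i => R i.succ) fun i j => hR i.succ j.succ
    obtain ⟨D, hD⟩ : ∃ D, D = R 0 - (Y * Q 0 - Q 0 * Y) := ⟨_, rfl⟩
    have h0 : D * Q 0 = -(Q 0 * D) := by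
      have h1 : (2 : ℝ) • (D * Q 0 + Q 0 * D) = 0 := by
        have e := congrArg₂ (· - ·) (hR 0 0) (hQ.commutator_relation Y 0 0)
        simp only [sub_zero] at e
        rw [← e, two_smul, hD]
        noncomm_ring
      exact eq_neg_of_add_eq_zero_left ((smul_eq_zero.mp h1).resolve_left two_ne_zero)
    have hs : ∀ i : Fin n, D * Q i.succ = -(Q i.succ * D) := by
      intro i
      have e := congrArg₂ (· - ·) (hR 0 i.succ) (hQ.commutator_relation Y 0 i.succ)
      simp only [sub_zero, hY i] at e
      refine eq_neg_of_add_eq_zero_left ?_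
      rw [← e, hD]
      noncomm_ring
    have hc0 : D * Q 0 * Q 0 - Q 0 * (D * Q 0) = (-2 : ℝ) • D := by
      have h1 : Q 0 * D = -(D * Q 0) := by rw [h0, neg_neg]
      rw [← mul_assoc (Q 0), h1, neg_mul, mul_assoc, hQ.mul_self 0, neg_smul, two_smul]
      noncomm_ring
    have hcs : ∀ i : Fin n, D * Q 0 * Q i.succ - Q i.succ * (D * Q 0) = 0 := by
      intro i
      have h1 : Q i.succ * D = -(D * Q i.succ) := by rw [hs i, neg_neg]
      rw [← mul_assoc (Q i.succ), h1, mul_assoc,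
        hQ.mul_eq_neg_mul (Fin.succ_ne_zero i).symm]
      noncomm_ring
    have hsplit : ∀ P : 𝔄, (Y + (-2⁻¹ : ℝ) • (D * Q 0)) * P - P * (Y + (-2⁻¹ : ℝ) • (D * Q 0))
        = (Y * P - P * Y) + (-2⁻¹ : ℝ) • (D * Q 0 * P - P * (D * Q 0)) := by
      intro P
      rw [add_mul, mul_add, smul_mul_assoc, mul_smul_comm, smul_sub]
      abel
    refine ⟨Y + (-2⁻¹ : ℝ) • (D * Q 0), fun i => ?_⟩
    rw [hsplit]
    cases i using Fin.cases with
    | zero =>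
      rw [hc0, smul_smul, show (-2⁻¹ : ℝ) * -2 = 1 by norm_num, one_smul, hD]
      abel
    | succ i => rw [hcs, smul_zero, add_zero]; exact hY i

end Algebra

theorem stmt13 {𝔄 : Type*} [Ring 𝔄] [Algebra ℝ 𝔄] {n : ℕ}
    (Q : Fin n → 𝔄) (hQ : IsCliffordSystem Q) :
    Set.BijOn (fun X : 𝔄 => fun i : Fin n => X * Q i - Q i * X)
      {X : 𝔄 | iterSym Q (fun _ => false) X = 0}
      {R : Fin n → 𝔄 | ∀ i j, R i * Q j + R j * Q i + Q i * R j + Q j * R i = 0} := by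
  refine ⟨fun X _ i j => hQ.commutator_relation X i j, fun X hX Y hY h => ?_, fun R hR => ?_⟩
  · have hZ : iterSym Q (fun _ => false) (X - Y) = X - Y := by
      refine iterSym_false_of_commute hQ fun i => ?_
      have hi : X * Q i - Q i * X = Y * Q i - Q i * Y := congrFun h i
      rw [sub_mul, mul_sub, sub_eq_sub_iff_sub_eq_sub, hi]
    rw [iterSym_false_sub, hX, hY, sub_zero] at hZ
    exact sub_eq_zero.mp hZ.symm
  · obtain ⟨X, hX⟩ := hQ.exists_commutator_eq hR
    refine ⟨X - iterSym Q (fun _ => false) X, ?_, funext fun i => ?_⟩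
    · rw [Set.mem_ofPred_eq, iterSym_false_sub,
        iterSym_false_of_commute hQ (iterSym_false_comm hQ X), sub_self]
    · simp only [sub_mul, mul_sub, iterSym_false_comm hQ X i]
      rw [← hX i]
      abel
end

section
/- Let 𝔄 be a unital associative algebra over ℝ and let (Q₁, …, Qₙ) be a floating Clifford system in 𝔄, i.e. each Qᵢ is invertible and (Q₂Q₁⁻¹, …, QₙQ₁⁻¹) is a Clifford system. Then the inverse system (Q₁⁻¹, …, Qₙ⁻¹) is also a floating Clifford system: (Q₂⁻¹Q₁, …, Qₙ⁻¹Q₁) is a Clifford system. -/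
namespace IsCliffordSystem

variable {𝔄 : Type*} [Ring 𝔄] {n : ℕ} {C : Fin n → 𝔄}

theorem mul_self_s14 [Algebra ℝ 𝔄] (hC : IsCliffordSystem C) (i : Fin n) : C i * C i = -1 := by
  have h : (2 : ℝ) • (C i * C i) = (2 : ℝ) • (-1 : 𝔄) := by
    rw [two_smul, two_smul, hC i i, if_pos rfl]
    norm_num
  exact smul_right_injective 𝔄 (two_ne_zero' ℝ) h

theorem neg (hC : IsCliffordSystem C) : IsCliffordSystem (fun i => -C i) := fun i j => by
  simpa only [neg_mul_neg] using hC i j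

theorem conj (hC : IsCliffordSystem C) (u : 𝔄ˣ) :
    IsCliffordSystem (fun i => ↑u⁻¹ * C i * u) := fun i j => by
  have h (x y : 𝔄) : (↑u⁻¹ * x * u) * (↑u⁻¹ * y * u) = ↑u⁻¹ * (x * y) * u := by
    simp only [mul_assoc, Units.mul_inv_cancel_left]
  rw [h, h, ← add_mul, ← mul_add, hC i j]
  split_ifs
  · rw [mul_neg, neg_mul, mul_assoc, (Commute.ofNat_left 2 (u : 𝔄)).eq,
      Units.inv_mul_cancel_left]
  · simp

end IsCliffordSystem

theorem stmt14 {𝔄 : Type*} [Ring 𝔄] [Algebra ℝ 𝔄] {n : ℕ}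
    (Q : Fin (n + 1) → 𝔄) (hinv : ∀ i, IsUnit (Q i))
    (hQ : IsCliffordSystem (fun i : Fin n => Q i.succ * Ring.inverse (Q 0))) :
    IsCliffordSystem (fun i : Fin n => Ring.inverse (Q i.succ) * Q 0) := by
  obtain ⟨u, hu⟩ := hinv 0
  have key (i : Fin n) :
      Ring.inverse (Q i.succ) * Q 0 = -(↑u⁻¹ * (Q i.succ * Ring.inverse (Q 0)) * u) := by
    have h := hQ.mul_self_s14 i
    obtain ⟨v, hv⟩ := hinv i.succ
    simp only [← hu, ← hv, Ring.inverse_unit] at h ⊢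
    have hvu : (v : 𝔄) * ↑u⁻¹ * v = -u := by
      rw [← Units.mul_left_inj u⁻¹, neg_mul, Units.mul_inv, ← h]
      simp only [mul_assoc]
    rw [← mul_assoc, Units.inv_mul_cancel_right, ← Units.mul_right_inj v,
      Units.mul_inv_cancel_left, mul_neg, ← mul_assoc, hvu, neg_neg]
  simpa only [key] using (hQ.conj u).neg
end
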